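/- arXiv:2410.08366 — 8 statements merged into one kernel-verified Lean document; each statement's English description precedes it below -/
import Mathlib

section
/- Let n ≥ 1 and 1 ≤ a ≤ n, and let h = (a,n,…,n). There exists a bijection φ from the set of exponent vectors (i_1,…,i_n) ∈ ℕ^n satisfying 0 ≤ i_j ≤ n−j for all j and i_ℓ = 0 for at least one ℓ with 1 ≤ ℓ ≤ a, onto the set of P_h-tableaux of column shape (1^n), such that for every such exponent vector i, the number of P_h-inversions of φ(i) equals i_1 + i_2 + ⋯ + i_n. -/
/-!
STATEMENT 1: For h = (a,n,…,n), there is a bijection between the exponent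
vectors (i_1,…,i_n) with 0 ≤ i_j ≤ n-j and i_ℓ = 0 for some 1 ≤ ℓ ≤ a
(indexing the first family of monomial basis elements of H^*(Hess(S,h))) and
the P_h-tableaux of column shape (1^n), carrying the total degree to the number
of P_h-inversions.

Conventions: entries and positions are 0-indexed; the 1-based value of
`j : Fin n` is `(j : ℕ) + 1`; the Hessenberg function h = (a,n,…,n) takes the
1-based value a at the first entry and n elsewhere. A column tableau is a
permutation σ, with σ r the entry in the r-th row from the bottom; the
P_h-tableau condition says σ(r+1) <_P σ(r) never holds, where i <_P j iff
h(i) < j (1-based values).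
-/

namespace Stmt1

/-- The Hessenberg function h = (a,n,…,n) in 0-indexed form. -/
def hFun (n a : ℕ) : Fin n → ℕ := fun j => if (j : ℕ) = 0 then a else n

/-- The set of P_h-tableaux of column shape (1^n), encoded as permutations. -/
def PTab (n : ℕ) (h : Fin n → ℕ) : Type :=
  {σ : Equiv.Perm (Fin n) //
    ∀ r s : Fin n, (s : ℕ) = (r : ℕ) + 1 → ¬ (h (σ s) < (σ r : ℕ) + 1)}

/-- The number of P_h-inversions of a column tableau σ. -/
def invP (n : ℕ) (h : Fin n → ℕ) (σ : Equiv.Perm (Fin n)) : ℕ :=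
  (Finset.univ.filter (fun p : Fin n × Fin n =>
    p.1 < p.2 ∧ σ p.2 < σ p.1 ∧ (σ p.1 : ℕ) + 1 ≤ h (σ p.2))).card

/-- Staircase vectors. -/
def Stair (m : ℕ) : Type := {i : Fin m → ℕ // ∀ j : Fin m, i j ≤ m - 1 - (j : ℕ)}

/-- Exponent vectors. -/
def Expo (n a : ℕ) : Type := {i : Fin n → ℕ //
        (∀ j : Fin n, i j ≤ n - 1 - (j : ℕ)) ∧
        ∃ ℓ : Fin n, (ℓ : ℕ) < a ∧ i ℓ = 0}

/-- Insert the minimal entry at position `p`. -/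
def ins {m : ℕ} (p : Fin (m+1)) (τ : Equiv.Perm (Fin m)) : Equiv.Perm (Fin (m+1)) :=
  (finSuccEquiv' p).trans ((Equiv.optionCongr τ).trans (finSuccEquiv' 0).symm)

lemma ins_self {m : ℕ} (p : Fin (m+1)) (τ : Equiv.Perm (Fin m)) : ins p τ p = 0 := by
  simp [ins]

lemma ins_succAbove {m : ℕ} (p : Fin (m+1)) (τ : Equiv.Perm (Fin m)) (x : Fin m) :
    ins p τ (p.succAbove x) = (τ x).succ := by
  simp [ins]

lemma ins_inj {m : ℕ} {p q : Fin (m+1)} {τ υ : Equiv.Perm (Fin m)}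
    (h : ins p τ = ins q υ) : p = q ∧ τ = υ := by
  have hp : p = q := by
    apply (ins q υ).injective
    rw [ins_self, ← h, ins_self]
  subst hp
  refine ⟨rfl, ?_⟩
  ext x
  have := ins_succAbove p τ x
  rw [h, ins_succAbove] at this
  rw [Fin.succ_inj.1 this]

lemma ins_surj {m : ℕ} (σ : Equiv.Perm (Fin (m+1))) : ∃ p τ, ins p τ = σ := by
  have hb : Function.Bijective
      (fun x : Fin (m+1) × Equiv.Perm (Fin m) => ins x.1 x.2) := by
    rw [Fintype.bijective_iff_injective_and_card]
    constructor
    · rintro ⟨p, τ⟩ ⟨q, υ⟩ h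
      obtain ⟨h1, h2⟩ := ins_inj h
      exact Prod.ext h1 h2
    · simp [Fintype.card_perm, Nat.factorial_succ]
  obtain ⟨⟨p, τ⟩, h⟩ := hb.2 σ
  exact ⟨p, τ, h⟩

/-- Number of small entries at positions before `p`. -/
def F {m : ℕ} (a : ℕ) (τ : Equiv.Perm (Fin m)) (p : ℕ) : ℕ :=
  (Finset.univ.filter (fun x : Fin m => (x : ℕ) < p ∧ (τ x : ℕ) + 1 < a)).card

lemma F_zero {m : ℕ} (a : ℕ) (τ : Equiv.Perm (Fin m)) : F a τ 0 = 0 := by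
  simp [F]

lemma F_mono {m : ℕ} (a : ℕ) (τ : Equiv.Perm (Fin m)) : Monotone (F a τ) := by
  intro p q h
  apply Finset.card_le_card
  intro x
  simp only [Finset.mem_filter, Finset.mem_univ, true_and]
  omega

lemma F_succ {m : ℕ} (a : ℕ) (τ : Equiv.Perm (Fin m)) (x : Fin m) :
    F a τ (x + 1) = F a τ x + if (τ x : ℕ) + 1 < a then 1 else 0 := by
  unfold F
  split_ifs with h
  · rw [← Finset.card_insert_of_notMem (a := x)]
    · congr 1
      ext y
      simp only [Finset.mem_filter, Finset.mem_univ, true_and, Finset.mem_insert, Fin.ext_iff]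
      constructor
      · rintro ⟨h1, h2⟩
        by_cases hy : (y : ℕ) = x
        · exact Or.inl hy
        · exact Or.inr ⟨by omega, h2⟩
      · rintro (h1 | h1)
        · have : y = x := Fin.ext h1
          subst this
          exact ⟨by omega, h⟩
        · exact ⟨by omega, h1.2⟩
    · simp
  · rw [add_zero]
    congr 1
    ext y
    simp only [Finset.mem_filter, Finset.mem_univ, true_and]
    constructor
    · rintro ⟨h1, h2⟩
      refine ⟨?_, h2⟩
      by_contra h3
      have : y = x := Fin.ext (by omega)
      subst this
      exact h h2
    · rintro ⟨h1, h2⟩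
      exact ⟨by omega, h2⟩

lemma F_top {m a : ℕ} (ha : 1 ≤ a) (han : a ≤ m + 1) (τ : Equiv.Perm (Fin m)) :
    F a τ m = a - 1 := by
  unfold F
  have : (Finset.univ.filter (fun x : Fin m => (x : ℕ) < m ∧ (τ x : ℕ) + 1 < a)).card
      = (Finset.univ.filter (fun x : Fin m => (x : ℕ) < a - 1)).card := by
    apply Finset.card_bij (fun x _ => τ x)
    · intro x
      simp only [Finset.mem_filter, Finset.mem_univ, true_and]
      omega
    · intro x _ y _ h
      exact τ.injective h
    · intro y
      simp only [Finset.mem_filter, Finset.mem_univ, true_and]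
      intro h
      refine ⟨τ.symm y, ⟨Fin.is_lt _, ?_⟩, by simp⟩
      simp
      omega
  rw [this, Fin.card_filter_val_lt]
  omega

/-- valid positions -/
def Valid {m : ℕ} (a : ℕ) (p : Fin (m+1)) (τ : Equiv.Perm (Fin m)) : Prop :=
  ∀ x : Fin m, (p : ℕ) = x + 1 → (τ x : ℕ) + 1 < a

lemma valid_iff {m a : ℕ} (p : Fin (m+1)) (τ : Equiv.Perm (Fin m)) :
    (∀ r s : Fin (m+1), (s : ℕ) = (r : ℕ) + 1 →
      ¬ (hFun (m+1) a (ins p τ s) < (ins p τ r : ℕ) + 1)) ↔ Valid a p τ := by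
  constructor
  · intro h x hx
    have hs : p.succAbove x = x.castSucc :=
      Fin.succAbove_of_castSucc_lt _ _ (by rw [Fin.lt_def]; simp; omega)
    have := h (p.succAbove x) p (by rw [hs]; simpa using hx)
    rw [ins_self, ins_succAbove] at this
    simp [hFun] at this
    omega
  · intro h r s hrs
    by_cases hs : s = p
    · subst hs
      have hr : (r : ℕ) < m := by omega
      have := h ⟨r, hr⟩ hrs
      have hs : s.succAbove ⟨r, hr⟩ = r := by
        rw [Fin.succAbove_of_castSucc_lt _ _ (by rw [Fin.lt_def]; simp; omega)]
        rfl
      have h2 := ins_succAbove s τ ⟨r, hr⟩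
      rw [hs] at h2
      rw [ins_self, h2]
      simp [hFun]
      omega
    · obtain ⟨y, rfl⟩ := Fin.exists_succAbove_eq hs
      rw [ins_succAbove]
      simp [hFun]
      omega

lemma inv_ins {m a : ℕ} (p : Fin (m+1)) (τ : Equiv.Perm (Fin m)) :
    invP (m+1) (hFun (m+1) a) (ins p τ) = F a τ p + invP m (hFun m m) τ := by
  unfold invP F
  simp only [Finset.card_filter, Fintype.sum_prod_type]
  rw [Fin.sum_univ_succAbove _ p]
  have h1 : ∀ x : Fin (m+1), ¬ (ins p τ x < ins p τ p) := by
    intro x; rw [ins_self]; simp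
  have h0 : ∀ x : Fin m, p.succAbove x < p ↔ (x : ℕ) < p := by
    intro x
    rw [Fin.succAbove_lt_iff_castSucc_lt, Fin.lt_def]; simp
  simp only [ins_self]
  simp only [Fin.sum_univ_succAbove _ p, ins_self, ins_succAbove, Fin.succAbove_lt_succAbove_iff,
    Fin.succ_lt_succ_iff, h0, Finset.sum_add_distrib]
  simp [hFun]

lemma perm_bij {m a : ℕ} (ha : 1 ≤ a) (han : a ≤ m + 1) :
    ∃ e : PTab (m+1) (hFun (m+1) a) ≃ Fin a × Equiv.Perm (Fin m),
      ∀ σ, invP (m+1) (hFun (m+1) a) σ.val = (e σ).1 + invP m (hFun m m) (e σ).2 := by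
  have key : ∀ x : Fin a × Equiv.Perm (Fin m), ∃ p : Fin (m+1), Valid a p x.2 ∧
      F a x.2 p = x.1 := by
    rintro ⟨k, τ⟩
    have hex : ∃ q, (k : ℕ) ≤ F a τ q := ⟨m, by rw [F_top ha han]; omega⟩
    classical
    have hle : Nat.find hex ≤ m := Nat.find_min' hex (by rw [F_top ha han]; omega)
    have hsp := Nat.find_spec hex
    rcases hq : Nat.find hex with _ | q
    · refine ⟨0, ?_, ?_⟩
      · intro x hx
        simp at hx
      · rw [hq, F_zero] at hsp
        simp [F_zero]
        omega
    · have hmin := Nat.find_min hex (m := q) (by omega)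
      have hqm : q < m := by omega
      have hs := F_succ a τ ⟨q, hqm⟩
      rw [hq] at hsp
      simp only at hs
      refine ⟨⟨q + 1, by omega⟩, ?_, ?_⟩
      · intro x hx
        have : x = ⟨q, hqm⟩ := Fin.ext (by simp only at hx ⊢; omega)
        subst this
        by_contra hc
        rw [if_neg hc] at hs
        omega
      · simp only
        split_ifs at hs <;> omega
  choose P hP1 hP2 using key
  have hb : Function.Bijective (fun x : Fin a × Equiv.Perm (Fin m) =>
      (⟨ins (P x) x.2, (valid_iff _ _).2 (hP1 x)⟩ : PTab (m+1) (hFun (m+1) a))) := by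
    constructor
    · intro x y h
      obtain ⟨h1, h2⟩ := ins_inj (congrArg Subtype.val h)
      have hx := hP2 x
      rw [h1, h2, hP2 y] at hx
      exact Prod.ext (Fin.ext hx.symm) h2
    · rintro ⟨σ, hσ⟩
      obtain ⟨p, τ, rfl⟩ := ins_surj σ
      have hv := (valid_iff _ _).1 hσ
      have hlt : F a τ p < a := by
        have := F_mono a τ (Nat.lt_succ_iff.1 p.is_lt)
        rw [F_top ha han] at this
        omega
      have aux : ∀ p q : Fin (m+1), Valid a q τ → p < q → F a τ p < F a τ q := by
        intro p q hq hpq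
        rw [Fin.lt_def] at hpq
        have hm : (q : ℕ) - 1 < m := by omega
        have h1 := hq ⟨q - 1, hm⟩ (by simp; omega)
        have h2 := F_succ a τ ⟨q - 1, hm⟩
        rw [if_pos h1] at h2
        have h3 : (q : ℕ) - 1 + 1 = q := by omega
        simp only [h3] at h2
        have := F_mono a τ (show (p : ℕ) ≤ q - 1 by omega)
        omega
      refine ⟨(⟨F a τ p, hlt⟩, τ), ?_⟩
      apply Subtype.ext
      simp only
      congr 1
      have e1 := hP1 (⟨F a τ p, hlt⟩, τ)
      have e2 := hP2 (⟨F a τ p, hlt⟩, τ)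
      simp only at e1 e2
      rcases lt_trichotomy (P (⟨F a τ p, hlt⟩, τ)) p with h | h | h
      · have := aux _ _ hv h
        omega
      · exact h
      · have := aux _ _ e1 h
        omega
  refine ⟨(Equiv.ofBijective _ hb).symm, ?_⟩
  intro σ
  have h1 : ins (P ((Equiv.ofBijective _ hb).symm σ)) ((Equiv.ofBijective _ hb).symm σ).2 = σ.val :=
    congrArg Subtype.val ((Equiv.ofBijective _ hb).apply_symm_apply σ)
  rw [← h1, inv_ins, hP2]
  rfl

/-- Build an exponent vector. -/
def mk {m : ℕ} (p : Fin (m+1)) (c : Fin m → ℕ) : Fin (m+1) → ℕ :=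
  p.insertNth (α := fun _ => ℕ) 0 (fun j => c j + if (j : ℕ) < p then 1 else 0)

lemma mk_self {m : ℕ} (p : Fin (m+1)) (c : Fin m → ℕ) : mk p c p = 0 := by
  simp [mk]

lemma mk_succAbove {m : ℕ} (p : Fin (m+1)) (c : Fin m → ℕ) (j : Fin m) :
    mk p c (p.succAbove j) = c j + if (j : ℕ) < p then 1 else 0 := by
  simp [mk]

lemma val_succAbove {m : ℕ} (p : Fin (m+1)) (j : Fin m) :
    (p.succAbove j : ℕ) = if (j : ℕ) < p then (j : ℕ) else j + 1 := by
  simp only [Fin.succAbove, Fin.lt_def, Fin.val_castSucc]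
  split_ifs <;> simp

lemma sum_mk {m : ℕ} (p : Fin (m+1)) (c : Fin m → ℕ) :
    ∑ j, mk p c j = p + ∑ j, c j := by
  rw [Fin.sum_univ_succAbove _ p]
  simp only [mk_self, mk_succAbove, Finset.sum_add_distrib, ← Finset.card_filter,
    Fin.card_filter_val_lt]
  omega

lemma mk_pos {m : ℕ} (p q : Fin (m+1)) (c : Fin m → ℕ) (h : q < p) : mk p c q ≠ 0 := by
  obtain ⟨y, rfl⟩ := Fin.exists_succAbove_eq h.ne
  rw [Fin.lt_def, val_succAbove] at h
  rw [mk_succAbove]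
  split_ifs at * <;> omega

lemma expo_bij {m a : ℕ} (han : a ≤ m + 1) :
    ∃ e : Fin a × Stair m ≃ Expo (m+1) a,
      ∀ x, ∑ j, (e x).val j = x.1 + ∑ j, x.2.val j := by
  have hb : Function.Bijective (fun x : Fin a × Stair m =>
      (⟨mk (Fin.castLE han x.1) x.2.val, by
        constructor
        · intro j
          by_cases hj : j = Fin.castLE han x.1
          · rw [hj, mk_self]; omega
          · obtain ⟨y, rfl⟩ := Fin.exists_succAbove_eq hj
            have := x.2.2 y
            rw [mk_succAbove, val_succAbove]
            split_ifs <;> omega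
        · exact ⟨Fin.castLE han x.1, by simp, mk_self _ _⟩⟩ : Expo (m+1) a)) := by
    constructor
    · rintro ⟨k, c⟩ ⟨l, d⟩ h
      have h : mk (Fin.castLE han k) c.val = mk (Fin.castLE han l) d.val := congrArg Subtype.val h
      have hkl : k = l := by
        rcases lt_trichotomy k l with h1 | h1 | h1
        · exact absurd (by rw [← h, mk_self]) (mk_pos (Fin.castLE han l) (Fin.castLE han k) d.val h1)
        · exact h1
        · exact absurd (by rw [h, mk_self]) (mk_pos (Fin.castLE han k) (Fin.castLE han l) c.val h1)
      subst hkl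
      refine Prod.ext rfl (Subtype.ext (funext fun j => ?_))
      have := congrFun h ((Fin.castLE han k).succAbove j)
      rw [mk_succAbove, mk_succAbove] at this
      simp only
      omega
    · rintro ⟨i, hi, hz⟩
      classical
      have hz' : ∃ k : ℕ, ∃ hk : k < a, i ⟨k, by omega⟩ = 0 := by
        obtain ⟨l, h1, h2⟩ := hz
        exact ⟨l, h1, h2⟩
      obtain ⟨hk, hk0⟩ := Nat.find_spec hz'
      have hmin : ∀ q (hq : q < m + 1), q < Nat.find hz' → i ⟨q, hq⟩ ≠ 0 := by
        intro q hq hlt h0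
        exact Nat.find_min hz' hlt ⟨by omega, h0⟩
      generalize Nat.find hz' = k at *
      set p : Fin (m+1) := ⟨k, by omega⟩ with hp
      refine ⟨(⟨k, hk⟩, ⟨fun j => i (p.succAbove j) - if (j : ℕ) < p then 1 else 0, ?_⟩), ?_⟩
      · intro j
        have := hi (p.succAbove j)
        rw [val_succAbove] at this
        have hjm := j.is_lt
        simp only
        split_ifs at this ⊢ with h
        · omega
        · omega
      · apply Subtype.ext
        funext j
        change mk p (fun j => i (p.succAbove j) - if (j : ℕ) < p then 1 else 0) j = i j
        by_cases hj : j = p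
        · rw [hj, mk_self, hk0]
        · obtain ⟨y, rfl⟩ := Fin.exists_succAbove_eq hj
          rw [mk_succAbove]
          split_ifs with h
          · have h2 : ((p.succAbove y : Fin (m+1)) : ℕ) < k := by
              rw [val_succAbove, if_pos h]; exact h
            have := hmin _ (p.succAbove y).is_lt h2
            simp only [Fin.eta] at this
            omega
          · omega
  refine ⟨Equiv.ofBijective _ hb, ?_⟩
  rintro ⟨k, c⟩
  exact sum_mk _ _

lemma step {m a : ℕ} (ha : 1 ≤ a) (han : a ≤ m + 1)
    (e : Stair m ≃ Equiv.Perm (Fin m)) (he : ∀ i, invP m (hFun m m) (e i) = ∑ j, i.val j) :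
    ∃ φ : Expo (m+1) a ≃ PTab (m+1) (hFun (m+1) a),
      ∀ i, invP (m+1) (hFun (m+1) a) (φ i).val = ∑ j, i.val j := by
  obtain ⟨f, hf⟩ := perm_bij ha han
  obtain ⟨g, hg⟩ := expo_bij han
  refine ⟨g.symm.trans ((Equiv.prodCongr (Equiv.refl _) e).trans f.symm), ?_⟩
  intro i
  obtain ⟨x, rfl⟩ := g.surjective i
  rw [hf, hg]
  simp [he]

lemma all_perm (m : ℕ) : ∃ e : Stair m ≃ Equiv.Perm (Fin m),
    ∀ i, invP m (hFun m m) (e i) = ∑ j, i.val j := by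
  induction m with
  | zero =>
    refine ⟨⟨fun _ => 1, fun _ => ⟨Fin.elim0, fun j => j.elim0⟩, ?_, ?_⟩, ?_⟩
    · intro x
      exact Subtype.ext (funext fun j => j.elim0)
    · intro x
      exact Subsingleton.elim _ _
    · intro i
      simp [invP]
  | succ m ih =>
    obtain ⟨e, he⟩ := ih
    obtain ⟨φ, hφ⟩ := step (a := m + 1) (by omega) le_rfl e he
    have t1 : ∀ i : Stair (m+1), ∃ ℓ : Fin (m+1), (ℓ : ℕ) < m + 1 ∧ i.val ℓ = 0 := by
      intro i
      refine ⟨Fin.last m, by simp, ?_⟩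
      have := i.2 (Fin.last m)
      simpa using this
    have t2 : ∀ σ : Equiv.Perm (Fin (m+1)), ∀ r s : Fin (m+1), (s : ℕ) = (r : ℕ) + 1 →
        ¬ (hFun (m+1) (m+1) (σ s) < (σ r : ℕ) + 1) := by
      intro σ r s _
      simp [hFun]
      omega
    refine ⟨⟨fun i => (φ ⟨i.1, i.2, t1 i⟩).val,
      fun σ => ⟨(φ.symm ⟨σ, t2 σ⟩).val, (φ.symm ⟨σ, t2 σ⟩).2.1⟩, ?_, ?_⟩, ?_⟩
    · intro i
      apply Subtype.ext
      have := congrArg Subtype.val (φ.symm_apply_apply ⟨i.1, i.2, t1 i⟩)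
      exact this
    · intro σ
      exact congrArg Subtype.val (φ.apply_symm_apply ⟨σ, t2 σ⟩)
    · intro i
      exact hφ ⟨i.1, i.2, t1 i⟩

theorem stmt1 (n a : ℕ) (hn : 0 < n) (ha : 1 ≤ a) (han : a ≤ n) :
    ∃ φ : {i : Fin n → ℕ //
        (∀ j : Fin n, i j ≤ n - 1 - (j : ℕ)) ∧
        ∃ ℓ : Fin n, (ℓ : ℕ) < a ∧ i ℓ = 0} ≃ PTab n (hFun n a),
      ∀ i, invP n (hFun n a) (φ i).val = ∑ j : Fin n, i.val j := by
  obtain ⟨m, rfl⟩ : ∃ m, n = m + 1 := ⟨n - 1, by omega⟩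
  obtain ⟨e, he⟩ := all_perm m
  exact step ha han e he

end Stmt1
end

section
/- Let n ≥ 2 and 1 ≤ a ≤ n, and let h = (a,n,…,n). There exists a bijection between the set of pairs ((ℓ_1,…,ℓ_{n−1}), k) with 0 ≤ ℓ_j ≤ n−1−j for all j, ℓ_m = 0 for at least one m with 1 ≤ m ≤ n−a, and 2 ≤ k ≤ n (indexing the basis elements x_n^{ℓ_1}⋯x_2^{ℓ_{n−1}}(y_k − y_1)), and the set of pairs (S,T) where S is a standard Young tableau of shape (2,1^{n−2}) and T is a P_h-tableau of shape (2,1^{n−2}); moreover the bijection sends ((ℓ_1,…,ℓ_{n−1}), k) to a pair (S,T) in which the second bottom-row entry of S equals k and the number of P_h-inversions of T equals (n−1)(n−2)/2 − (ℓ_1 + ⋯ + ℓ_{n−1}). -/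
/-!
STATEMENT 2: For h = (a,n,…,n), there is a bijection between the pairs
((ℓ_1,…,ℓ_{n-1}), k) indexing the basis elements x_n^{ℓ_1}⋯x_2^{ℓ_{n-1}}(y_k - y_1)
and the pairs (S,T) with S a standard Young tableau of shape (2,1^{n-2}) and T a
P_h-tableau of shape (2,1^{n-2}); the bijection preserves the bottom-row label k
and sends the total ℓ-degree to (n-1)(n-2)/2 minus the number of P_h-inversions.

Conventions/encodings (following the context):
* A standard Young tableau of shape (2,1^{n-2}) is determined by its second
  bottom-row entry, a number k with 2 ≤ k ≤ n; we encode it by that number.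
* A P_h-tableau of shape (2,1^{n-2}) is encoded by the pair (b, τ) where
  (1, b) is the bottom row (a+1 ≤ b ≤ n) and τ lists the column entries from
  bottom to top: an injective map Fin (n-2) → Fin n avoiding the (0-indexed
  versions of the) entries 1 and b.  All such pairs are valid P_h-tableaux.
* The number of P_h-inversions of (b, τ) is (b - 2) + #{r < s : τ(s) < τ(r)}.
* Entries of τ are 0-indexed: the 1-based entry is (τ r : ℕ) + 1.
-/

namespace Stmt2

/-- The set of standard Young tableaux of shape (2,1^{n-2}), encoded by the
second bottom-row entry. -/
def SYTHook (n : ℕ) : Type := {k : ℕ // 2 ≤ k ∧ k ≤ n}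

/-- The set of P_h-tableaux of shape (2,1^{n-2}) for h = (a,n,…,n), encoded as
pairs (b, τ): bottom row (1,b) with a+1 ≤ b ≤ n, and column entries τ
(injective, avoiding the entries 1 and b). -/
def PTabHook (n a : ℕ) : Type :=
  {p : ℕ × (Fin (n - 2) → Fin n) //
    (a + 1 ≤ p.1 ∧ p.1 ≤ n) ∧ Function.Injective p.2 ∧
    ∀ r : Fin (n - 2), (p.2 r : ℕ) + 1 ≠ 1 ∧ (p.2 r : ℕ) + 1 ≠ p.1}

/-- The number of P_h-inversions of the encoded hook tableau (b, τ):
(b - 2) + #{r < s : τ(s) < τ(r)}. -/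
def invHook (n : ℕ) (p : ℕ × (Fin (n - 2) → Fin n)) : ℕ :=
  (p.1 - 2) +
    (Finset.univ.filter (fun q : Fin (n - 2) × Fin (n - 2) =>
      q.1 < q.2 ∧ p.2 q.2 < p.2 q.1)).card

/-- The index set of the second family of basis elements: exponent vectors
(ℓ_1,…,ℓ_{n-1}) with 0 ≤ ℓ_j ≤ n-1-j (1-based; 0-indexed: q.1 j ≤ n-2-j),
ℓ_m = 0 for some 1 ≤ m ≤ n-a, together with k with 2 ≤ k ≤ n. -/
def BIdx (n a : ℕ) : Type :=
  {q : (Fin (n - 1) → ℕ) × ℕ //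
    (∀ j : Fin (n - 1), q.1 j ≤ n - 2 - (j : ℕ)) ∧
    (∃ m : Fin (n - 1), (m : ℕ) < n - a ∧ q.1 m = 0) ∧
    2 ≤ q.2 ∧ q.2 ≤ n}

/-- Lehmer code. -/
def lcode {M : ℕ} (σ : Equiv.Perm (Fin M)) (r : Fin M) : ℕ :=
  (Finset.univ.filter (fun s : Fin M => r < s ∧ σ s < σ r)).card

lemma lcode_le {M : ℕ} (σ : Equiv.Perm (Fin M)) (r : Fin M) : lcode σ r ≤ M - 1 - (r : ℕ) := by
  have h : lcode σ r ≤ (Finset.Ioi r).card := by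
    apply Finset.card_le_card
    intro s hs
    simp at hs ⊢
    exact hs.1
  simpa using h

lemma lcode_eq {M : ℕ} (σ : Equiv.Perm (Fin M)) (r : Fin M) :
    lcode σ r = (Finset.univ.filter (fun x : Fin M => r < σ.symm x ∧ x < σ r)).card := by
  unfold lcode
  refine Finset.card_bij (fun s _ => σ s) ?_ ?_ ?_
  · intro s hs
    simpa using hs
  · intro s _ t _ h
    exact σ.injective h
  · intro x hx
    refine ⟨σ.symm x, ?_, by simp⟩
    simpa using hx

lemma lcode_lt {M : ℕ} (σ σ' : Equiv.Perm (Fin M)) (r : Fin M)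
    (h : ∀ s < r, σ s = σ' s) (hlt : σ r < σ' r) : lcode σ r < lcode σ' r := by
  have key : ∀ x, r ≤ σ.symm x → r ≤ σ'.symm x := by
    intro x hx
    by_contra hc
    push Not at hc
    have h1 := h _ hc
    simp at h1
    rw [← h1] at hx
    simp at hx
    omega
  rw [lcode_eq, lcode_eq]
  apply Finset.card_lt_card
  rw [Finset.ssubset_iff_of_subset]
  · refine ⟨σ r, ?_, by simp⟩
    simp only [Finset.mem_filter, Finset.mem_univ, true_and]
    refine ⟨lt_of_le_of_ne (key _ (by simp)) ?_, hlt⟩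
    intro hc
    have : σ' r = σ r := (σ'.symm_apply_eq.1 hc.symm).symm
    omega
  · intro x hx
    simp only [Finset.mem_filter, Finset.mem_univ, true_and] at hx ⊢
    have hx' := hx.2.trans hlt
    refine ⟨lt_of_le_of_ne (key _ hx.1.le) ?_, hx'⟩
    intro hc
    have : σ' r = x := by rw [hc]; simp
    omega

lemma lcode_inj {M : ℕ} (σ σ' : Equiv.Perm (Fin M)) (h : ∀ r, lcode σ r = lcode σ' r) :
    σ = σ' := by
  have : ∀ k : ℕ, ∀ r : Fin M, (r : ℕ) = k → σ r = σ' r := by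
    intro k
    induction k using Nat.strong_induction_on with
    | _ k ih =>
      intro r hr
      have hs : ∀ s < r, σ s = σ' s := fun s hs => ih s (by rw [← hr]; exact hs) s rfl
      rcases lt_trichotomy (σ r) (σ' r) with h1 | h1 | h1
      · have := lcode_lt σ σ' r hs h1
        have := h r
        omega
      · exact h1
      · have := lcode_lt σ' σ r (fun s h => (hs s h).symm) h1
        have := h r
        omega
  ext r
  rw [this r r rfl]

/-- Bounded sequences. -/
abbrev Cod (M : ℕ) : Type := {d : Fin M → ℕ // ∀ i, d i ≤ M - 1 - (i : ℕ)}

/-- Bounded sequences as a product. -/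
def codEquiv (M : ℕ) : Cod M ≃ ((i : Fin M) → Fin (M - 1 - (i : ℕ) + 1)) where
  toFun d i := ⟨d.1 i, Nat.lt_succ_of_le (d.2 i)⟩
  invFun f := ⟨fun i => f i, fun i => Nat.le_of_lt_succ (f i).2⟩
  left_inv d := rfl
  right_inv f := rfl

lemma card_cod (M : ℕ) : Nat.card (Cod M) = M.factorial := by
  rw [Nat.card_congr (codEquiv M), Nat.card_eq_fintype_card, Fintype.card_pi]
  simp only [Fintype.card_fin]
  rw [Fin.prod_univ_eq_prod_range (fun i => M - 1 - i + 1) M,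
    Finset.prod_range_reflect (fun i => i + 1) M, Finset.prod_range_add_one_eq_factorial]

/-- Complemented Lehmer code. -/
def lmap (M : ℕ) (σ : Equiv.Perm (Fin M)) : Cod M :=
  ⟨fun i => M - 1 - (i : ℕ) - lcode σ i, fun i => Nat.sub_le _ _⟩

lemma lmap_bij (M : ℕ) : Function.Bijective (lmap M) := by
  have : Finite (Cod M) := Finite.of_equiv _ (codEquiv M).symm
  have hinj : Function.Injective (lmap M) := by
    intro σ σ' h
    apply lcode_inj
    intro r
    have := congrFun (congrArg Subtype.val h) r
    simp only [lmap] at this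
    have h1 := lcode_le σ r
    have h2 := lcode_le σ' r
    omega
  refine (Nat.bijective_iff_injective_and_card _).2 ⟨hinj, ?_⟩
  rw [card_cod, Nat.card_eq_fintype_card, Fintype.card_perm, Fintype.card_fin]

lemma sum_stair (M : ℕ) : (∑ i : Fin M, (M - 1 - (i : ℕ))) * 2 = M * (M - 1) := by
  rw [Fin.sum_univ_eq_sum_range (fun i => M - 1 - i) M, Finset.sum_range_reflect (fun i => i) M,
    Finset.sum_range_id_mul_two]

lemma sum_lcode {M : ℕ} (σ : Equiv.Perm (Fin M)) :
    (Finset.univ.filter (fun q : Fin M × Fin M => q.1 < q.2 ∧ σ q.2 < σ q.1)).card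
      = ∑ r, lcode σ r := by
  simp only [lcode, Finset.card_filter, ← Finset.univ_product_univ, Finset.sum_product]

lemma sum_lmap {M : ℕ} (σ : Equiv.Perm (Fin M)) :
    ((∑ r, lcode σ r) + ∑ r, (lmap M σ).1 r) * 2 = M * (M - 1) := by
  rw [← sum_stair, ← Finset.sum_add_distrib]
  congr 1
  apply Finset.sum_congr rfl
  intro r _
  have := lcode_le σ r
  simp only [lmap]
  omega

/-- Admissible second entries (shifted by two). -/
abbrev Pos (M a : ℕ) : Type := {p : Fin (M + 1) // a ≤ (p : ℕ) + 1}

/-- Insert the first zero. -/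
def ins {M : ℕ} (m : Fin (M + 1)) (d : Fin M → ℕ) : Fin (M + 1) → ℕ :=
  Fin.insertNth (α := fun _ => ℕ) m 0 (fun i => d i + if i.castSucc < m then 1 else 0)

lemma ins_same {M : ℕ} (m : Fin (M + 1)) (d : Fin M → ℕ) : ins m d m = 0 := by
  simp [ins]

lemma ins_above {M : ℕ} (m : Fin (M + 1)) (d : Fin M → ℕ) (i : Fin M) :
    ins m d (m.succAbove i) = d i + if i.castSucc < m then 1 else 0 := by
  simp [ins]

lemma ins_pos {M : ℕ} (m : Fin (M + 1)) (d : Fin M → ℕ) (j : Fin (M + 1)) (h : j < m) :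
    0 < ins m d j := by
  obtain ⟨i, rfl⟩ := Fin.exists_succAbove_eq (ne_of_lt h)
  rw [ins_above, if_pos]
  · omega
  · exact (Fin.succAbove_lt_iff_castSucc_lt _ _).1 h

lemma ins_bound {M : ℕ} (m : Fin (M + 1)) (d : Fin M → ℕ) (hd : ∀ i, d i ≤ M - 1 - (i : ℕ))
    (j : Fin (M + 1)) : ins m d j ≤ M - (j : ℕ) := by
  by_cases h : j = m
  · subst h
    rw [ins_same]
    omega
  · obtain ⟨i, rfl⟩ := Fin.exists_succAbove_eq h
    rw [ins_above]
    have := hd i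
    have := i.2
    split_ifs with h1
    · rw [Fin.succAbove_of_castSucc_lt _ _ h1]
      simp
      omega
    · rw [Fin.succAbove_of_le_castSucc _ _ (not_lt.1 h1)]
      simp
      omega

lemma ins_sum {M : ℕ} (m : Fin (M + 1)) (d : Fin M → ℕ) :
    ∑ j, ins m d j = (m : ℕ) + ∑ i, d i := by
  rw [Fin.sum_univ_succAbove _ m, ins_same]
  simp only [ins_above, Finset.sum_add_distrib]
  have : (∑ i : Fin M, if i.castSucc < m then 1 else 0) = (m : ℕ) := by
    have h2 := Fin.sum_univ_castSucc (fun j : Fin (M + 1) => if j < m then 1 else 0)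
    have h3 : ∑ j : Fin (M + 1), (if j < m then 1 else 0) = (m : ℕ) := by
      rw [← Finset.card_filter]
      have : (Finset.univ.filter (fun j => j < m)) = Finset.Iio m := by ext; simp
      rw [this, Fin.card_Iio]
    have h4 : ¬ (Fin.last M < m) := not_lt.2 (Fin.le_last m)
    rw [h3, if_neg h4] at h2
    simpa using h2.symm
  rw [this]
  omega

/-- Exponent vectors. -/
abbrev Exps (M a : ℕ) : Type := {l : Fin (M + 1) → ℕ //
  (∀ j, l j ≤ M - (j : ℕ)) ∧ ∃ m : Fin (M + 1), (m : ℕ) < M + 2 - a ∧ l m = 0}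

/-- Insertion map. -/
def imap (M a : ℕ) (x : Pos M a × Cod M) : Exps M a :=
  ⟨ins x.1.1.rev x.2.1, ins_bound _ _ x.2.2, x.1.1.rev,
    by have := x.1.2; have := x.1.1.2; rw [Fin.val_rev]; omega, ins_same _ _⟩

lemma imap_bij (M a : ℕ) : Function.Bijective (imap M a) := by
  constructor
  · rintro ⟨⟨p, hp⟩, ⟨d, hd⟩⟩ ⟨⟨p', hp'⟩, ⟨d', hd'⟩⟩ h
    have h := congrArg Subtype.val h
    simp only [imap] at h
    have hpp : p.rev = p'.rev := by
      rcases lt_trichotomy p.rev p'.rev with h1 | h1 | h1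
      · have := ins_pos p'.rev d' p.rev h1
        rw [← h, ins_same] at this
        omega
      · exact h1
      · have := ins_pos p.rev d p'.rev h1
        rw [h, ins_same] at this
        omega
    have hpp := Fin.rev_injective hpp
    subst hpp
    have : d = d' := by
      ext i
      have := congrFun h (p.rev.succAbove i)
      rw [ins_above, ins_above] at this
      omega
    subst this
    rfl
  · rintro ⟨l, hl, m0, hm0, hz0⟩
    obtain ⟨m, hm, hmin⟩ : ∃ m, l m = 0 ∧ ∀ j < m, l j ≠ 0 := by
      obtain ⟨m, hm, hmin⟩ := WellFounded.has_min (wellFounded_lt (α := Fin (M + 1)))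
        {j | l j = 0} ⟨m0, hz0⟩
      exact ⟨m, hm, fun j hj hc => hmin j hc hj⟩
    have hmm : m ≤ m0 := by
      by_contra hc
      exact hmin m0 (not_le.1 hc) hz0
    have hmm' : (m : ℕ) ≤ m0 := hmm
    refine ⟨⟨⟨m.rev, ?_⟩, ⟨fun i => l (m.succAbove i) - if i.castSucc < m then 1 else 0, ?_⟩⟩, ?_⟩
    · rw [Fin.val_rev]
      omega
    · intro i
      have h := hl (m.succAbove i)
      have := i.2
      show l (m.succAbove i) - _ ≤ _
      split_ifs with h1
      · rw [Fin.succAbove_of_castSucc_lt _ _ h1] at h ⊢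
        simp at h ⊢
        omega
      · rw [Fin.succAbove_of_le_castSucc _ _ (not_lt.1 h1)] at h ⊢
        simp at h ⊢
        omega
    · apply Subtype.ext
      funext j
      simp only [imap, Fin.rev_rev]
      by_cases h : j = m
      · subst h
        rw [ins_same, hm]
      · obtain ⟨i, rfl⟩ := Fin.exists_succAbove_eq h
        rw [ins_above]
        split_ifs with h1
        · have := hmin (m.succAbove i) ((Fin.succAbove_lt_iff_castSucc_lt _ _).2 h1)
          omega
        · omega

/-- Tableau from position and permutation. -/
def tmap (M a : ℕ) (x : Pos M a × Equiv.Perm (Fin M)) : PTabHook (M + 2) a :=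
  ⟨((x.1.1 : ℕ) + 2, fun r => (x.1.1.succAbove (x.2 r)).succ), by
    have h1 := x.1.2
    have h2 := x.1.1.2
    refine ⟨⟨by simp only; omega, by simp only; omega⟩, ?_, ?_⟩
    · intro r s h
      exact x.2.injective (Fin.succAbove_right_injective (Fin.succ_injective _ h))
    · intro r
      refine ⟨by simp, ?_⟩
      intro hc
      apply Fin.succAbove_ne x.1.1 (x.2 r)
      apply Fin.ext
      simpa using hc⟩

lemma tmap_bij (M a : ℕ) (ha : 1 ≤ a) : Function.Bijective (tmap M a) := by
  constructor
  · rintro ⟨⟨p, hp⟩, σ⟩ ⟨⟨p', hp'⟩, σ'⟩ h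
    have h := congrArg Subtype.val h
    simp only [tmap, Prod.mk.injEq] at h
    obtain ⟨h1, h2⟩ := h
    have hpp : p = p' := Fin.ext (by omega)
    subst hpp
    have : σ = σ' := by
      apply Equiv.ext
      intro r
      exact Fin.succAbove_right_injective (Fin.succ_injective _ (congrFun h2 r))
    rw [this]
  · rintro ⟨⟨b, τ⟩, ⟨hb1, hb2⟩, hinj, hav⟩
    change Fin M → Fin (M + 2) at τ
    simp only at hb1 hb2 hinj hav
    let p : Fin (M + 1) := ⟨b - 2, by omega⟩
    have hpv : (p : ℕ) = b - 2 := rfl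
    have hex : ∀ r : Fin M, ∃ i : Fin M, (p.succAbove i).succ = τ r := by
      intro r
      obtain ⟨h1, h2⟩ := hav r
      obtain ⟨t, ht⟩ := Fin.exists_succ_eq.2 (show τ r ≠ 0 by
        intro hc
        apply h1
        rw [hc]
        rfl)
      have hne : t ≠ p := by
        intro hc
        apply h2
        rw [← ht, hc, Fin.val_succ]
        omega
      obtain ⟨i, hi⟩ := Fin.exists_succAbove_eq hne
      exact ⟨i, by rw [hi, ht]⟩
    choose f hf using hex
    have hfi : Function.Injective f := by
      intro r s h
      apply hinj
      rw [← hf r, ← hf s, h]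
    refine ⟨⟨⟨p, by omega⟩, Equiv.ofBijective f (Finite.injective_iff_bijective.1 hfi)⟩, ?_⟩
    apply Subtype.ext
    simp only [tmap]
    refine Prod.ext ?_ ?_
    · simp only
      omega
    · funext r
      exact hf r

lemma inv_tmap (M a : ℕ) (x : Pos M a × Equiv.Perm (Fin M)) :
    invHook (M + 2) (tmap M a x).1 = (x.1.1 : ℕ) + ∑ r, lcode x.2 r := by
  rw [← sum_lcode]
  unfold invHook tmap
  simp only [Nat.add_sub_cancel, Fin.succ_lt_succ_iff]
  congr 2
  ext q
  simp only [Finset.mem_filter, Finset.mem_univ, true_and]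
  exact and_congr Iff.rfl ((Fin.strictMono_succAbove x.1.1).lt_iff_lt)

/-- Split off the label. -/
def bsplit (M a : ℕ) : BIdx (M + 2) a ≃ SYTHook (M + 2) × Exps M a where
  toFun q := (⟨q.1.2, q.2.2.2⟩, ⟨q.1.1, q.2.1, q.2.2.1⟩)
  invFun x := ⟨(x.2.1, x.1.1), x.2.2.1, x.2.2.2, x.1.2⟩
  left_inv _ := rfl
  right_inv _ := rfl

theorem stmt2 (n a : ℕ) (hn : 2 ≤ n) (ha : 1 ≤ a) (han : a ≤ n) :
    ∃ e : BIdx n a ≃ SYTHook n × PTabHook n a,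
      ∀ q : BIdx n a,
        (e q).1.val = q.val.2 ∧
        invHook n (e q).2.val = (n - 1) * (n - 2) / 2 - ∑ j : Fin (n - 1), q.val.1 j := by
  obtain ⟨M, rfl⟩ : ∃ M, n = M + 2 := ⟨n - 2, by omega⟩
  let eI := Equiv.ofBijective _ (imap_bij M a)
  let eT := Equiv.ofBijective _ (tmap_bij M a ha)
  let eL := Equiv.ofBijective _ (lmap_bij M)
  let e2 : Exps M a ≃ PTabHook (M + 2) a :=
    eI.symm.trans (((Equiv.refl (Pos M a)).prodCongr eL.symm).trans eT)
  refine ⟨(bsplit M a).trans ((Equiv.refl _).prodCongr e2), ?_⟩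
  intro q
  refine ⟨rfl, ?_⟩
  change invHook (M + 2) (e2 ⟨q.1.1, q.2.1, q.2.2.1⟩).1
    = (M + 1) * M / 2 - ∑ j : Fin (M + 1), q.val.1 j
  have key : ∀ l : Exps M a, invHook (M + 2) (e2 l).1 = (M + 1) * M / 2 - ∑ j, l.1 j := by
    intro l
    obtain ⟨⟨p, d⟩, rfl⟩ := eI.surjective l
    obtain ⟨σ, rfl⟩ := eL.surjective d
    have h1 : e2 (eI (p, eL σ)) = tmap M a (p, σ) := by
      simp [e2, eT]
    have h2 : (eI (p, eL σ)).1 = ins p.1.rev (lmap M σ).1 := rfl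
    rw [h1, h2, ins_sum, inv_tmap, Fin.val_rev]
    have h3 := sum_lmap σ
    have h4 : (M + 1) * M = M * (M - 1) + 2 * M := by
      cases M with
      | zero => rfl
      | succ k => simp; ring
    have := p.1.2
    simp only
    omega
  exact key _

end Stmt2
end

section
/- Let h be any Hessenberg function of length n ≥ 1. There exists a bijection φ from the set of exponent vectors (i_1,…,i_n) ∈ ℕ^n satisfying 0 ≤ i_k ≤ h(k) − k for all k (which index the monomial basis of the cohomology of the regular nilpotent Hessenberg variety Hess(N,h)) onto the set of P_h-tableaux of column shape (1^n), such that for every such exponent vector i, the number of P_h-inversions of φ(i) equals i_1 + i_2 + ⋯ + i_n. -/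
/-!
STATEMENT 3: For any Hessenberg function h of length n, there is a bijection
between the exponent vectors (i_1,…,i_n) with 0 ≤ i_k ≤ h(k) - k (indexing the
monomial basis of H^*(Hess(N,h)) for N regular nilpotent) and the P_h-tableaux
of column shape (1^n), carrying the total degree to the number of
P_h-inversions.

Conventions: entries and positions are 0-indexed; the 1-based value of
`j : Fin n` is `(j : ℕ) + 1`, and `h : Fin n → ℕ` takes 1-based values.
A column tableau is a permutation σ, with σ r the entry in the r-th row from
the bottom; the P_h-tableau condition says σ(r+1) <_P σ(r) never holds, where
i <_P j iff h(i) < j (1-based values).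
-/

namespace Stmt3

/-- The set of P_h-tableaux of column shape (1^n), encoded as permutations. -/
def PTab (n : ℕ) (h : Fin n → ℕ) : Type :=
  {σ : Equiv.Perm (Fin n) //
    ∀ r s : Fin n, (s : ℕ) = (r : ℕ) + 1 → ¬ (h (σ s) < (σ r : ℕ) + 1)}

/-- The number of P_h-inversions of a column tableau σ: pairs r < s with
σ(s) < σ(r) and σ(r), σ(s) incomparable in P_h (equivalently σ(r) ≤ h(σ(s))
in 1-based values). -/
def invP (n : ℕ) (h : Fin n → ℕ) (σ : Equiv.Perm (Fin n)) : ℕ :=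
  (Finset.univ.filter (fun p : Fin n × Fin n =>
    p.1 < p.2 ∧ σ p.2 < σ p.1 ∧ (σ p.1 : ℕ) + 1 ≤ h (σ p.2))).card

/-- Words on the letters `m, …, n-1`, each used once, satisfying the tableau condition. -/
def InS (n : ℕ) (H : ℕ → ℕ) (m : ℕ) (L : List ℕ) : Prop :=
  L.Nodup ∧ (∀ a, a ∈ L ↔ m ≤ a ∧ a < n) ∧ L.IsChain (fun a b => a < H b)

/-- Number of inversions whose smaller letter is `k`. -/
def code (H : ℕ → ℕ) (L : List ℕ) (k : ℕ) : ℕ :=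
  (L.takeWhile (fun a => decide (a ≠ k))).countP (fun a => decide (k < a ∧ a < H k))

lemma code_remove (H : ℕ → ℕ) (A B : List ℕ) (m k : ℕ) (hk : m < k) :
    code H (A ++ m :: B) k = code H (A ++ B) k := by
  induction A with
  | nil =>
    have h1 : m ≠ k := by omega
    have h2 : ¬ (k < m) := by omega
    simp [code, h1, h2]
  | cons a A ih =>
    unfold code at *
    by_cases h : a = k
    · simp [h]
    · simp only [List.cons_append, List.takeWhile_cons, ne_eq, h, not_false_eq_true,
        decide_true, if_true, List.countP_cons] at *
      rw [ih]

lemma code_self (H : ℕ → ℕ) (A B : List ℕ) (m : ℕ) (hA : ∀ a ∈ A, m < a) :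
    code H (A ++ m :: B) m = A.countP (fun a => decide (a < H m)) := by
  induction A with
  | nil => simp [code]
  | cons a A ih =>
    have h0 : m < a := hA a (by simp)
    have ih := ih (fun x hx => hA x (by simp [hx]))
    have h : a ≠ m := by omega
    unfold code at *
    simp only [List.cons_append, List.takeWhile_cons, ne_eq, h, not_false_eq_true,
        decide_true, if_true, List.countP_cons] at *
    rw [ih]
    simp [h0]

lemma exists_split (p : ℕ → Bool) (L : List ℕ) (c : ℕ) (hc : c ≤ L.countP p) :
    ∃ A B, L = A ++ B ∧ A.countP p = c ∧ ∀ x ∈ A.getLast?, p x := by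
  induction L using List.reverseRecOn with
  | nil => exact ⟨[], [], by simp, by simp at hc ⊢; omega, by simp⟩
  | append_singleton L x ih =>
    by_cases h : c ≤ L.countP p
    · obtain ⟨A, B, h1, h2, h3⟩ := ih h
      exact ⟨A, B ++ [x], by simp [h1], h2, h3⟩
    · have hx : p x = true := by
        by_contra hx
        simp [List.countP_append, hx] at hc
        omega
      refine ⟨L ++ [x], [], by simp, ?_, by simp [hx]⟩
      simp [List.countP_append, hx] at hc ⊢
      omega

lemma split_unique_aux (p : ℕ → Bool) (A C : List ℕ)
    (hA : ∀ x ∈ (A ++ C).getLast?, p x) (hc : (A ++ C).countP p = A.countP p) : C = [] := by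
  rcases List.eq_nil_or_concat C with h | ⟨D, x, rfl⟩
  · exact h
  · exfalso
    have : p x = true := by
      apply hA
      simp [← List.append_assoc]
    simp [List.countP_append, this] at hc

lemma split_unique (p : ℕ → Bool) (A B A' B' : List ℕ) (h : A ++ B = A' ++ B')
    (hA : ∀ x ∈ A.getLast?, p x) (hA' : ∀ x ∈ A'.getLast?, p x)
    (hc : A.countP p = A'.countP p) : A = A' ∧ B = B' := by
  rcases List.append_eq_append_iff.1 h with ⟨C, h1, h2⟩ | ⟨C, h1, h2⟩
  · subst h1
    have := split_unique_aux p A C hA' hc.symm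
    subst this
    simpa using h2
  · subst h1
    have := split_unique_aux p A' C hA hc
    subst this
    simpa using h2.symm

section
variable {n : ℕ} {H : ℕ → ℕ}

lemma InS_remove (hmono : ∀ a b, a ≤ b → b < n → H a ≤ H b) {m : ℕ} {L : List ℕ}
    (hm : m < n) (hL : InS n H m L) :
    ∃ A B, L = A ++ m :: B ∧ InS n H (m+1) (A ++ B) ∧ (∀ a ∈ A, m < a) ∧
      (∀ x ∈ A.getLast?, decide (x < H m) = true) := by
  obtain ⟨h1, h2, h3⟩ := hL
  obtain ⟨A, B, rfl⟩ := List.append_of_mem ((h2 m).2 ⟨le_rfl, hm⟩)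
  have hnd := List.nodup_middle.1 h1
  rw [List.nodup_cons] at hnd
  have hmem : ∀ a, a ∈ A ++ B ↔ m + 1 ≤ a ∧ a < n := by
    intro a
    have := h2 a
    have h5 := hnd.1
    constructor
    · intro ha
      have h6 : a ≠ m := by rintro rfl; exact h5 ha
      have h7 : a ∈ A ++ m :: B := by simp at ha ⊢; tauto
      have := this.1 h7
      omega
    · intro ha
      have h7 := this.2 ⟨by omega, ha.2⟩
      have h6 : a ≠ m := by omega
      simp [h6] at h7 ⊢
      exact h7
  rw [List.isChain_append] at h3
  obtain ⟨c1, c2, c3⟩ := h3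
  have hlast : ∀ x ∈ A.getLast?, x < H m := fun x hx => c3 x hx m (by simp)
  refine ⟨A, B, rfl, ⟨hnd.2, hmem, ?_⟩, ?_, ?_⟩
  · rw [List.isChain_append]
    refine ⟨c1, c2.tail, ?_⟩
    intro x hx y hy
    have hy' := (hmem y).1 (by simp [List.mem_of_mem_head? hy])
    exact lt_of_lt_of_le (hlast x hx) (hmono _ _ (by omega) hy'.2)
  · intro a ha
    have := (hmem a).1 (by simp [ha])
    omega
  · simpa using hlast

lemma InS_insert (hub : ∀ a, a < n → a < H a) {m : ℕ} {A B : List ℕ}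
    (hm : m < n) (hL : InS n H (m+1) (A ++ B))
    (hlast : ∀ x ∈ A.getLast?, decide (x < H m) = true) : InS n H m (A ++ m :: B) := by
  obtain ⟨h1, h2, h3⟩ := hL
  refine ⟨?_, ?_, ?_⟩
  · rw [List.nodup_middle, List.nodup_cons]
    refine ⟨?_, h1⟩
    rw [h2]; omega
  · intro a
    have := h2 a
    by_cases h : a = m
    · subst h; simp [hm]
    · simp [h] at this ⊢
      rw [this]; omega
  · rw [List.isChain_append] at h3 ⊢
    obtain ⟨c1, c2, c3⟩ := h3
    refine ⟨c1, ?_, ?_⟩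
    · rw [List.isChain_cons]
      refine ⟨?_, c2⟩
      intro y hy
      have hy' := (h2 y).1 (by simp [List.mem_of_mem_head? hy])
      have := hub y hy'.2
      omega
    · intro x hx y hy
      simp at hy
      subst hy
      simpa using hlast x hx

lemma code_inj (hmono : ∀ a b, a ≤ b → b < n → H a ≤ H b) (d : ℕ) :
    ∀ m, m + d = n → ∀ L L', InS n H m L → InS n H m L' →
      (∀ k, m ≤ k → k < n → code H L k = code H L' k) → L = L' := by
  induction d with
  | zero =>
    intro m hm L L' hL hL' _
    have e : ∀ L, InS n H m L → L = [] := by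
      intro L hL
      rw [List.eq_nil_iff_forall_not_mem]
      intro a ha
      have := (hL.2.1 a).1 ha
      omega
    rw [e L hL, e L' hL']
  | succ d ih =>
    intro m hm L L' hL hL' hcode
    obtain ⟨A, B, rfl, hS, hA, hl⟩ := InS_remove hmono (by omega) hL
    obtain ⟨A', B', rfl, hS', hA', hl'⟩ := InS_remove hmono (by omega) hL'
    have e := ih (m+1) (by omega) _ _ hS hS' (fun k hk hk' => by
      have := hcode k (by omega) hk'
      rwa [code_remove _ _ _ _ _ (by omega), code_remove _ _ _ _ _ (by omega)] at this)
    have c := hcode m le_rfl (by omega)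
    rw [code_self _ _ _ _ hA, code_self _ _ _ _ hA'] at c
    obtain ⟨rfl, rfl⟩ := split_unique _ A B A' B' e hl hl' c
    rfl

lemma InS_count {m c : ℕ} {L : List ℕ} (hL : InS n H (m+1) L) (hc : c ≤ n) :
    L.countP (fun a => decide (a < c)) = c - (m+1) := by
  obtain ⟨h1, h2, -⟩ := hL
  rw [List.countP_eq_length_filter, ← List.toFinset_card_of_nodup (h1.filter _),
    ← Nat.card_Ico]
  congr 1
  ext a
  simp [h2]
  omega

lemma code_surj (hub : ∀ a, a < n → a < H a) (hlb : ∀ a, a < n → H a ≤ n)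
    (i : ℕ → ℕ) (hi : ∀ k, k < n → i k ≤ H k - (k+1)) (d : ℕ) :
    ∀ m, m + d = n → ∃ L, InS n H m L ∧ ∀ k, m ≤ k → k < n → code H L k = i k := by
  induction d with
  | zero =>
    intro m hm
    refine ⟨[], ⟨by simp, ?_, by simp⟩, ?_⟩
    · intro a; simp; omega
    · intro k _ _; omega
  | succ d ih =>
    intro m hm
    obtain ⟨L, hL, hc⟩ := ih (m+1) (by omega)
    obtain ⟨A, B, rfl, hA, hl⟩ := exists_split (fun a => decide (a < H m)) L (i m)
      (by rw [InS_count hL (hlb m (by omega))]; exact hi m (by omega))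
    refine ⟨A ++ m :: B, InS_insert hub (by omega) hL hl, ?_⟩
    intro k hk hk'
    rcases Nat.eq_or_lt_of_le hk with rfl | h
    · rw [code_self, hA]
      intro a ha
      have := (hL.2.1 a).1 (by simp [ha])
      omega
    · rw [code_remove _ _ _ _ _ h]
      exact hc k h hk'

end

lemma countP_takeWhile_ofFn (n : ℕ) (f : Fin n → ℕ) (hf : Function.Injective f) (s : Fin n)
    (p : ℕ → Prop) [DecidablePred p] :
    ((List.ofFn f).takeWhile (fun a => decide (a ≠ f s))).countP (fun a => decide (p a)) =
      (Finset.univ.filter (fun r => r < s ∧ p (f r))).card := by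
  induction n with
  | zero => exact s.elim0
  | succ n ih =>
    rw [List.ofFn_succ]
    refine Fin.cases ?_ (fun t => ?_) s
    · simp
    · have h0 : f 0 ≠ f t.succ := fun h => (Fin.succ_ne_zero t) (hf h).symm
      have := ih (fun r => f r.succ) (fun a b h => Fin.succ_injective _ (hf h)) t
      rw [Fin.card_filter_univ_succ]
      simp only [List.takeWhile_cons, ne_eq, h0, not_false_eq_true,
        decide_true, if_true, List.countP_cons] at this ⊢
      rw [this]
      simp only [Fin.succ_lt_succ_iff, Fin.succ_pos, true_and,
        decide_eq_true_eq]
      split_ifs <;> rfl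

/-- Extension of `h` to naturals. -/
def ext (n : ℕ) (h : Fin n → ℕ) (k : ℕ) : ℕ := if hk : k < n then h ⟨k, hk⟩ else 0

lemma ext_fin (n : ℕ) (h : Fin n → ℕ) (k : Fin n) : ext n h k = h k := by
  simp [ext]

/-- The word of a permutation. -/
def word {n : ℕ} (σ : Equiv.Perm (Fin n)) : List ℕ := List.ofFn (fun r => (σ r : ℕ))

lemma val_inj {n : ℕ} (σ : Equiv.Perm (Fin n)) :
    Function.Injective (fun r => (σ r : ℕ)) := fun _ _ h => σ.injective (Fin.ext h)

lemma code_word {n : ℕ} (h : Fin n → ℕ) (σ : Equiv.Perm (Fin n)) (s : Fin n) :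
    code (ext n h) (word σ) (σ s) = (Finset.univ.filter (fun r : Fin n =>
      r < s ∧ σ s < σ r ∧ (σ r : ℕ) + 1 ≤ h (σ s))).card := by
  have := countP_takeWhile_ofFn n (fun r => (σ r : ℕ)) (val_inj σ) s
    (fun a => (σ s : ℕ) < a ∧ a < ext n h (σ s))
  unfold code word
  rw [this, ext_fin]
  rfl

lemma code_le {n : ℕ} (h : Fin n → ℕ) (σ : Equiv.Perm (Fin n)) (k : Fin n) :
    code (ext n h) (word σ) k ≤ h k - ((k : ℕ) + 1) := by
  obtain ⟨s, rfl⟩ := σ.surjective k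
  rw [code_word, ← Nat.card_Ico, ← Finset.card_image_of_injective _ (val_inj σ)]
  apply Finset.card_le_card
  intro a ha
  simp only [Finset.mem_image, Finset.mem_filter, Finset.mem_univ, true_and,
    Finset.mem_Ico] at ha ⊢
  obtain ⟨r, ⟨-, h1, h2⟩, rfl⟩ := ha
  rw [Fin.lt_def] at h1
  omega

lemma invP_eq {n : ℕ} (h : Fin n → ℕ) (σ : Equiv.Perm (Fin n)) :
    invP n h σ = ∑ k : Fin n, code (ext n h) (word σ) k := by
  rw [← Equiv.sum_comp σ]
  simp only [code_word]
  unfold invP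
  simp only [Finset.card_filter]
  rw [Fintype.sum_prod_type_right]

lemma word_chain {n : ℕ} (h : Fin n → ℕ) (σ : Equiv.Perm (Fin n)) :
    (word σ).IsChain (fun a b => a < ext n h b) ↔
    ∀ r s : Fin n, (s : ℕ) = (r : ℕ) + 1 → ¬ (h (σ s) < (σ r : ℕ) + 1) := by
  rw [List.isChain_iff_getElem]
  simp only [word, List.length_ofFn, List.getElem_ofFn, ext_fin]
  constructor
  · intro H r s hrs
    have := H r (by omega)
    have e : (⟨(r : ℕ) + 1, by omega⟩ : Fin n) = s := Fin.ext hrs.symm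
    simp only [e] at this
    simp at this
    omega
  · intro H i hi
    have := H ⟨i, by omega⟩ ⟨i+1, by omega⟩ rfl
    omega

lemma word_InS {n : ℕ} (h : Fin n → ℕ) (σ : PTab n h) : InS n (ext n h) 0 (word σ.1) := by
  refine ⟨?_, ?_, (word_chain h σ.1).2 σ.2⟩
  · exact List.nodup_ofFn.2 (val_inj σ.1)
  · intro a
    simp only [word, List.mem_ofFn, Nat.zero_le, true_and]
    constructor
    · rintro ⟨r, rfl⟩; exact (σ.1 r).2
    · intro ha
      exact ⟨σ.1.symm ⟨a, ha⟩, by simp⟩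

lemma exists_word {n : ℕ} (h : Fin n → ℕ) (L : List ℕ) (hL : InS n (ext n h) 0 L) :
    ∃ σ : PTab n h, word σ.1 = L := by
  have hlen : L.length = n := by
    rw [← List.toFinset_card_of_nodup hL.1]
    have : L.toFinset = Finset.range n := by
      ext a; simp [hL.2.1]
    rw [this, Finset.card_range]
  have hlt : ∀ r : Fin n, L[(r : ℕ)] < n := fun r => ((hL.2.1 _).1 (List.getElem_mem _)).2
  let f : Fin n → Fin n := fun r => ⟨L[(r : ℕ)], hlt r⟩
  have hf : Function.Injective f := by
    intro a b hab
    have : L[(a : ℕ)] = L[(b : ℕ)] := congrArg Fin.val hab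
    exact Fin.ext ((hL.1.getElem_inj_iff).1 this)
  let σ : Equiv.Perm (Fin n) := Equiv.ofBijective f (Finite.injective_iff_bijective.1 hf)
  have hw : word σ = L := by
    apply List.ext_getElem
    · simp [word, hlen]
    · intro i h1 h2
      simp [word, σ, f]
  exact ⟨⟨σ, (word_chain h σ).1 (hw ▸ hL.2.2)⟩, hw⟩

theorem stmt3 (n : ℕ) (hn : 0 < n) (h : Fin n → ℕ)
    (hub : ∀ j : Fin n, (j : ℕ) + 1 ≤ h j) (hlb : ∀ j : Fin n, h j ≤ n)
    (hmono : Monotone h) :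
    ∃ φ : {i : Fin n → ℕ // ∀ k : Fin n, i k ≤ h k - ((k : ℕ) + 1)} ≃ PTab n h,
      ∀ i, invP n h (φ i).val = ∑ k : Fin n, i.val k := by
  let ψ : PTab n h → {i : Fin n → ℕ // ∀ k : Fin n, i k ≤ h k - ((k : ℕ) + 1)} :=
    fun σ => ⟨fun k => code (ext n h) (word σ.1) k, fun k => code_le h σ.1 k⟩
  have hψ : Function.Bijective ψ := by
    constructor
    · intro σ τ hst
      have hw : word σ.1 = word τ.1 := by
        refine code_inj (n := n) (H := ext n h) ?_ n 0 (by simp) _ _ (word_InS h σ)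
          (word_InS h τ) ?_
        · intro a b hab hb
          have ha : a < n := by omega
          simp only [ext, ha, hb, dif_pos]
          exact hmono hab
        · intro k _ hk
          exact congrFun (congrArg Subtype.val hst) ⟨k, hk⟩
      apply Subtype.ext
      apply Equiv.ext
      intro r
      exact Fin.ext (congrFun (List.ofFn_injective hw) r)
    · intro i
      obtain ⟨L, hL, hc⟩ := code_surj (n := n) (H := ext n h)
        (fun a ha => by simpa [ext, ha] using hub ⟨a, ha⟩)
        (fun a ha => by simpa [ext, ha] using hlb ⟨a, ha⟩)
        (ext n i.1) (fun k hk => by simpa [ext, hk] using i.2 ⟨k, hk⟩) n 0 (by simp)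
      obtain ⟨σ, rfl⟩ := exists_word h L hL
      refine ⟨σ, Subtype.ext (funext fun k => ?_)⟩
      have := hc k (by simp) k.2
      rwa [ext_fin] at this
  refine ⟨(Equiv.ofBijective ψ hψ).symm, fun i => ?_⟩
  rw [invP_eq]
  have : ψ ((Equiv.ofBijective ψ hψ).symm i) = i := (Equiv.ofBijective ψ hψ).apply_symm_apply i
  conv_rhs => rw [← this]

end Stmt3
end

section
/- Let n ≥ 1, let h be a Hessenberg function of length n, and let h' be its transpose, defined by h'(i) = #{j ∈ {1,…,n} : h(j) > n − i}. Let W be the n×n permutation matrix of the permutation i ↦ n+1−i, let X be any n×n complex matrix, and let H(h) = {M ∈ M_n(ℂ) : M_{ij} = 0 whenever i > h(j)}. Then for every invertible g ∈ GL_n(ℂ): g^{−1} X g ∈ H(h) if and only if (g')^{−1} X^T g' ∈ H(h'), where g' = ((gW)^{−1})^T. Consequently the map g ↦ ((gW)^{−1})^T is a bijection from {g ∈ GL_n(ℂ) : g^{−1} X g ∈ H(h)} onto {g ∈ GL_n(ℂ) : g^{−1} X^T g ∈ H(h')}. -/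
/-!
STATEMENT 5: For any n×n complex matrix X, any Hessenberg function h with
transpose h', and W the permutation matrix of i ↦ n+1-i: for every invertible
g, g⁻¹Xg ∈ H(h) iff (g')⁻¹ Xᵀ g' ∈ H(h') where g' = ((gW)⁻¹)ᵀ; consequently
g ↦ ((gW)⁻¹)ᵀ is a bijection between the two sets of invertible matrices.

Conventions: 0-based indices, the 1-based value of `i : Fin n` is `(i:ℕ)+1`;
Hessenberg functions take 1-based values; `⁻¹` is Matrix.inv (the genuine
inverse on invertible matrices).
-/

open Matrix

namespace Stmt5

/-- Membership in H(h): M_{ij} = 0 whenever i > h(j) (1-based). -/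
def Hmem (n : ℕ) (h : Fin n → ℕ) (M : Matrix (Fin n) (Fin n) ℂ) : Prop :=
  ∀ i j : Fin n, h j < (i : ℕ) + 1 → M i j = 0

/-- The transpose Hessenberg function h'(i) = #{j : h(j) > n - i} (1-based). -/
def htr (n : ℕ) (h : Fin n → ℕ) : Fin n → ℕ := fun i =>
  (Finset.univ.filter (fun j : Fin n => n - ((i : ℕ) + 1) < h j)).card

/-- The permutation matrix W of the permutation i ↦ n+1-i (1-based),
i.e. W_{ij} = 1 iff i + j + 1 = n (0-based). -/
def Wm (n : ℕ) : Matrix (Fin n) (Fin n) ℂ :=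
  Matrix.of fun i j => if (i : ℕ) + (j : ℕ) + 1 = n then 1 else 0

theorem mul_Wm (n : ℕ) (A : Matrix (Fin n) (Fin n) ℂ) (i j : Fin n) :
    (A * Wm n) i j = A i j.rev := by
  rw [Matrix.mul_apply, Finset.sum_eq_single j.rev]
  · have : ((j.rev : Fin n) : ℕ) + (j : ℕ) + 1 = n := by
      rw [Fin.val_rev]; omega
    simp only [Wm, Matrix.of_apply, if_pos this, mul_one]
  · intro b _ hb
    have : ¬ ((b : ℕ) + (j : ℕ) + 1 = n) := by
      intro hh
      apply hb
      ext
      rw [Fin.val_rev]; omega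
    simp only [Wm, Matrix.of_apply, if_neg this, mul_zero]
  · intro hh
    exact absurd (Finset.mem_univ _) hh

theorem Wm_transpose (n : ℕ) : (Wm n)ᵀ = Wm n := by
  ext i j
  simp only [Wm, Matrix.transpose_apply, Matrix.of_apply]
  congr 1
  rw [add_comm (j : ℕ)]

theorem Wm_mul (n : ℕ) (A : Matrix (Fin n) (Fin n) ℂ) (i j : Fin n) :
    (Wm n * A) i j = A i.rev j := by
  have := mul_Wm n Aᵀ j i
  rw [← Wm_transpose, ← Matrix.transpose_mul] at this
  simpa [Wm_transpose] using this

theorem Wm_sq (n : ℕ) : Wm n * Wm n = 1 := by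
  ext i j
  rw [mul_Wm]
  simp only [Wm, Matrix.of_apply, Matrix.one_apply, Fin.val_rev, Fin.ext_iff]
  congr 1
  apply propext
  omega

theorem htr_lt (n : ℕ) (h : Fin n → ℕ) (hmono : Monotone h) (i j : Fin n) :
    htr n h j < (i : ℕ) + 1 ↔ h i.rev < (j.rev : ℕ) + 1 := by
  unfold htr
  have hj : n - ((j : ℕ) + 1) = (j.rev : ℕ) := by rw [Fin.val_rev]
  rw [hj]
  constructor
  · intro hc
    by_contra hp
    have hsub : Finset.Ici i.rev ⊆
        Finset.univ.filter (fun k : Fin n => (j.rev : ℕ) < h k) := by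
      intro k hk
      have := hmono (Finset.mem_Ici.1 hk)
      simp only [Finset.mem_filter, Finset.mem_univ, true_and]
      omega
    have := Finset.card_le_card hsub
    rw [Fin.card_Ici, Fin.val_rev i] at this
    omega
  · intro hp
    have hsub : Finset.univ.filter (fun k : Fin n => (j.rev : ℕ) < h k) ⊆
        Finset.Ioi i.rev := by
      intro k hk
      simp only [Finset.mem_filter, Finset.mem_univ, true_and] at hk
      rw [Finset.mem_Ioi]
      by_contra hle
      have := hmono (not_lt.1 hle)
      omega
    have := Finset.card_le_card hsub
    rw [Fin.card_Ioi, Fin.val_rev i] at this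
    omega

theorem Hmem_flip (n : ℕ) (h : Fin n → ℕ) (hmono : Monotone h)
    (M : Matrix (Fin n) (Fin n) ℂ) :
    Hmem n h M ↔ Hmem n (htr n h) (Wm n * M * Wm n)ᵀ := by
  unfold Hmem
  simp only [htr_lt n h hmono, Matrix.transpose_apply, mul_Wm, Wm_mul]
  constructor
  · intro H i j hij
    exact H _ _ hij
  · intro H i j hij
    have := H j.rev i.rev
    simp only [Fin.rev_rev] at this
    exact this hij

theorem Wm_inv (n : ℕ) : (Wm n)⁻¹ = Wm n := Matrix.inv_eq_left_inv (Wm_sq n)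

theorem Wm_det (n : ℕ) : IsUnit (Wm n).det :=
  Matrix.isUnit_det_of_left_inverse (Wm_sq n)

theorem conj_eq (n : ℕ) (X g : Matrix (Fin n) (Fin n) ℂ) (hg : IsUnit g.det) :
    (((g * Wm n)⁻¹)ᵀ)⁻¹ * Xᵀ * ((g * Wm n)⁻¹)ᵀ = (Wm n * (g⁻¹ * X * g) * Wm n)ᵀ := by
  have hd : IsUnit (g * Wm n).det := by
    rw [Matrix.det_mul]; exact hg.mul (Wm_det n)
  rw [← Matrix.transpose_nonsing_inv, Matrix.nonsing_inv_nonsing_inv _ hd,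
    ← Matrix.transpose_mul, ← Matrix.transpose_mul, Matrix.mul_inv_rev, Wm_inv]
  simp only [Matrix.mul_assoc]

theorem stmt5 (n : ℕ) (hn : 0 < n) (h : Fin n → ℕ)
    (hub : ∀ j : Fin n, (j : ℕ) + 1 ≤ h j) (hlb : ∀ j : Fin n, h j ≤ n)
    (hmono : Monotone h) (X : Matrix (Fin n) (Fin n) ℂ) :
    (∀ g : Matrix (Fin n) (Fin n) ℂ, IsUnit g.det →
      (Hmem n h (g⁻¹ * X * g) ↔
        Hmem n (htr n h)
          ((((g * Wm n)⁻¹)ᵀ)⁻¹ * Xᵀ * ((g * Wm n)⁻¹)ᵀ))) ∧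
    Set.BijOn (fun g => ((g * Wm n)⁻¹)ᵀ)
      {g : Matrix (Fin n) (Fin n) ℂ | IsUnit g.det ∧ Hmem n h (g⁻¹ * X * g)}
      {g : Matrix (Fin n) (Fin n) ℂ | IsUnit g.det ∧ Hmem n (htr n h) (g⁻¹ * Xᵀ * g)} := by
  have key : ∀ g : Matrix (Fin n) (Fin n) ℂ, IsUnit g.det →
      (Hmem n h (g⁻¹ * X * g) ↔
        Hmem n (htr n h)
          ((((g * Wm n)⁻¹)ᵀ)⁻¹ * Xᵀ * ((g * Wm n)⁻¹)ᵀ)) := by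
    intro g hg
    rw [conj_eq n X g hg]
    exact Hmem_flip n h hmono _
  have hunit : ∀ g : Matrix (Fin n) (Fin n) ℂ, IsUnit g.det → IsUnit (g * Wm n).det := by
    intro g hg
    rw [Matrix.det_mul]; exact hg.mul (Wm_det n)
  refine ⟨key, ?_, ?_, ?_⟩
  · rintro g ⟨hg, hM⟩
    refine ⟨?_, (key g hg).1 hM⟩
    rw [Matrix.det_transpose]
    exact Matrix.isUnit_nonsing_inv_det _ (hunit g hg)
  · rintro a ⟨ha, _⟩ b ⟨hb, _⟩ hab
    have h1 := congrArg (fun M => (Mᵀ)⁻¹ * Wm n) hab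
    simpa only [Matrix.transpose_transpose, Matrix.nonsing_inv_nonsing_inv _ (hunit a ha),
      Matrix.nonsing_inv_nonsing_inv _ (hunit b hb), Matrix.mul_assoc, Wm_sq,
      Matrix.mul_one] using h1
  · rintro k ⟨hk, hM⟩
    have hkT : IsUnit (kᵀ).det := by rwa [Matrix.det_transpose]
    have hu : IsUnit ((kᵀ)⁻¹ * Wm n).det := hunit _ (Matrix.isUnit_nonsing_inv_det _ hkT)
    have he : ((((kᵀ)⁻¹ * Wm n) * Wm n)⁻¹)ᵀ = k := by
      rw [Matrix.mul_assoc, Wm_sq, Matrix.mul_one, Matrix.nonsing_inv_nonsing_inv _ hkT,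
        Matrix.transpose_transpose]
    refine ⟨(kᵀ)⁻¹ * Wm n, ⟨hu, ?_⟩, he⟩
    rw [key _ hu, he]
    exact hM

end Stmt5
end

section
/- Let n ≥ 1, let h be a Hessenberg function of length n with transpose h', and let X be a diagonalizable n×n complex matrix (i.e. there exists m ∈ GL_n(ℂ) with m^{−1}Xm diagonal). Let B ⊆ GL_n(ℂ) be the subgroup of invertible upper-triangular matrices, and for a subset A ⊆ GL_n(ℂ) closed under right multiplication by B, let A/B denote its quotient by the equivalence g ∼ g b for b ∈ B. Then there is a bijection between {g ∈ GL_n(ℂ) : g^{−1}Xg ∈ H(h)}/B and {g ∈ GL_n(ℂ) : g^{−1}Xg ∈ H(h')}/B. -/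
/-!
STATEMENT 6: For a diagonalizable X and any Hessenberg function h with
transpose h', there is a bijection between the coset spaces
{g : g⁻¹Xg ∈ H(h)}/B and {g : g⁻¹Xg ∈ H(h')}/B, where B is the group of
invertible upper-triangular matrices.  The coset space A/B is encoded as the
set of right B-cosets {gB : g ∈ A} (a set of subsets of matrices).

Conventions: 0-based indices, the 1-based value of `i : Fin n` is `(i:ℕ)+1`;
Hessenberg functions take 1-based values; `⁻¹` is Matrix.inv.
-/

open Matrix

namespace Stmt6

/-- Membership in H(h): M_{ij} = 0 whenever i > h(j) (1-based). -/
def Hmem (n : ℕ) (h : Fin n → ℕ) (M : Matrix (Fin n) (Fin n) ℂ) : Prop :=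
  ∀ i j : Fin n, h j < (i : ℕ) + 1 → M i j = 0

/-- The transpose Hessenberg function h'(i) = #{j : h(j) > n - i} (1-based). -/
def htr (n : ℕ) (h : Fin n → ℕ) : Fin n → ℕ := fun i =>
  (Finset.univ.filter (fun j : Fin n => n - ((i : ℕ) + 1) < h j)).card

/-- The invertible upper-triangular matrices (entries strictly below the
diagonal vanish). -/
def Bset (n : ℕ) : Set (Matrix (Fin n) (Fin n) ℂ) :=
  {b | IsUnit b.det ∧ ∀ i j : Fin n, j < i → b i j = 0}

/-- The set {g ∈ GL_n(ℂ) : g⁻¹Xg ∈ H(h)}. -/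
def hessSet (n : ℕ) (h : Fin n → ℕ) (X : Matrix (Fin n) (Fin n) ℂ) :
    Set (Matrix (Fin n) (Fin n) ℂ) :=
  {g | IsUnit g.det ∧ Hmem n h (g⁻¹ * X * g)}

/-- The set of right B-cosets of elements of {g : g⁻¹Xg ∈ H(h)},
encoding the quotient {g : g⁻¹Xg ∈ H(h)}/B. -/
def cosets (n : ℕ) (h : Fin n → ℕ) (X : Matrix (Fin n) (Fin n) ℂ) :
    Set (Set (Matrix (Fin n) (Fin n) ℂ)) :=
  {S | ∃ g ∈ hessSet n h X, S = {g' | ∃ b ∈ Bset n, g' = g * b}}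

/-- The reversal permutation matrix. -/
def Wm (n : ℕ) : Matrix (Fin n) (Fin n) ℂ :=
  (1 : Matrix (Fin n) (Fin n) ℂ).submatrix id Fin.rev

lemma mul_Wm (n : ℕ) (A : Matrix (Fin n) (Fin n) ℂ) (i j : Fin n) :
    (A * Wm n) i j = A i (Fin.rev j) := by
  simp [Wm, Matrix.mul_apply, Matrix.one_apply]

lemma Wm_tr (n : ℕ) : (Wm n)ᵀ = Wm n := by
  ext i j
  simp only [Wm, Matrix.transpose_apply, Matrix.submatrix_apply, Matrix.one_apply, id]
  congr 1
  rw [eq_iff_iff]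
  constructor
  · rintro h; rw [h, Fin.rev_rev]
  · rintro h; rw [h, Fin.rev_rev]

lemma Wm_mul (n : ℕ) (A : Matrix (Fin n) (Fin n) ℂ) (i j : Fin n) :
    (Wm n * A) i j = A (Fin.rev i) j := by
  have h := mul_Wm n Aᵀ j i
  rw [← Wm_tr n, ← Matrix.transpose_mul] at h
  simpa using h

lemma Wm_Wm (n : ℕ) : Wm n * Wm n = 1 := by
  ext i j
  rw [mul_Wm, Wm, Matrix.submatrix_apply, Fin.rev_rev, id]

lemma Wm_inv (n : ℕ) : (Wm n)⁻¹ = Wm n := Matrix.inv_eq_right_inv (Wm_Wm n)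

lemma Wm_det (n : ℕ) : IsUnit (Wm n).det := by
  have : (Wm n).det * (Wm n).det = 1 := by rw [← Matrix.det_mul, Wm_Wm, Matrix.det_one]
  exact IsUnit.of_mul_eq_one _ this

/-- The duality on invertible matrices. -/
noncomputable def phi (n : ℕ) (S g : Matrix (Fin n) (Fin n) ℂ) : Matrix (Fin n) (Fin n) ℂ :=
  S * (g⁻¹)ᵀ * Wm n

lemma phi_det (n : ℕ) (S g : Matrix (Fin n) (Fin n) ℂ) (hS : IsUnit S.det)
    (hg : IsUnit g.det) : IsUnit (phi n S g).det := by
  have hg' : IsUnit (g⁻¹).det := Matrix.isUnit_nonsing_inv_det g hg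
  rw [phi, Matrix.det_mul, Matrix.det_mul, Matrix.det_transpose]
  exact (hS.mul hg').mul (Wm_det n)

lemma phi_inv (n : ℕ) (S g : Matrix (Fin n) (Fin n) ℂ)
    (hg : IsUnit g.det) : (phi n S g)⁻¹ = Wm n * gᵀ * S⁻¹ := by
  rw [phi, Matrix.mul_inv_rev, Matrix.mul_inv_rev, Wm_inv, ← Matrix.transpose_nonsing_inv,
    Matrix.nonsing_inv_nonsing_inv g hg, Matrix.mul_assoc]

lemma phi_phi (n : ℕ) (S g : Matrix (Fin n) (Fin n) ℂ) (hS : IsUnit S.det) (hSt : Sᵀ = S)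
    (hg : IsUnit g.det) : phi n S (phi n S g) = g := by
  rw [phi, phi_inv n S g hg]
  simp only [Matrix.transpose_mul, Matrix.transpose_transpose, Wm_tr,
    Matrix.transpose_nonsing_inv, hSt]
  rw [Matrix.mul_nonsing_inv_cancel_left _ _ hS, Matrix.mul_assoc, Wm_Wm, Matrix.mul_one]

lemma phi_one_B (n : ℕ) (b : Matrix (Fin n) (Fin n) ℂ) (hb : b ∈ Bset n) :
    Wm n * (b⁻¹)ᵀ * Wm n ∈ Bset n := by
  obtain ⟨hd, ht⟩ := hb
  refine ⟨?_, ?_⟩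
  · have := phi_det n (Wm n) b (Wm_det n) hd
    exact this
  · intro i j hij
    rw [mul_Wm, Wm_mul, Matrix.transpose_apply]
    haveI := Matrix.invertibleOfIsUnitDet b hd
    have hbt : Matrix.BlockTriangular b id := fun i j hij => ht i j hij
    exact Matrix.blockTriangular_inv_of_blockTriangular hbt (Fin.rev_lt_rev.mpr hij)

lemma phi_mul (n : ℕ) (S g b : Matrix (Fin n) (Fin n) ℂ) :
    phi n S (g * b) = phi n S g * (Wm n * (b⁻¹)ᵀ * Wm n) := by
  rw [phi, phi, Matrix.mul_inv_rev, Matrix.transpose_mul]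
  simp only [Matrix.mul_assoc]
  rw [← Matrix.mul_assoc (Wm n) (Wm n), Wm_Wm, Matrix.one_mul]

lemma phi_conj (n : ℕ) (S X g : Matrix (Fin n) (Fin n) ℂ) (hS : IsUnit S.det)
    (hX : X * S = S * Xᵀ) (hg : IsUnit g.det) :
    (phi n S g)⁻¹ * X * phi n S g = Wm n * (g⁻¹ * X * g)ᵀ * Wm n := by
  rw [phi_inv n S g hg, phi]
  simp only [Matrix.transpose_mul, Matrix.mul_assoc]
  rw [← Matrix.mul_assoc X S, hX, Matrix.mul_assoc S, Matrix.nonsing_inv_mul_cancel_left _ _ hS]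

lemma htr_iff (n : ℕ) (h : Fin n → ℕ) (hmono : Monotone h) (i j : Fin n) :
    htr n h j < (i : ℕ) + 1 ↔ h (Fin.rev i) < (Fin.rev j : ℕ) + 1 := by
  have hr : (Fin.rev j : ℕ) = n - ((j : ℕ) + 1) := Fin.val_rev j
  unfold htr
  rw [← hr]
  constructor
  · intro H
    by_contra hc
    have hsub : Finset.Ici (Fin.rev i) ⊆
        Finset.univ.filter (fun k : Fin n => (Fin.rev j : ℕ) < h k) := by
      intro k hk
      have := hmono (Finset.mem_Ici.mp hk)
      simp only [Finset.mem_filter, Finset.mem_univ, true_and]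
      omega
    have := Finset.card_le_card hsub
    rw [Fin.card_Ici] at this
    have := Fin.val_rev i
    have := i.isLt
    omega
  · intro H
    have hsub : Finset.univ.filter (fun k : Fin n => (Fin.rev j : ℕ) < h k) ⊆
        Finset.Ioi (Fin.rev i) := by
      intro k hk
      simp only [Finset.mem_filter, Finset.mem_univ, true_and] at hk
      rw [Finset.mem_Ioi]
      by_contra hc
      have := hmono (not_lt.mp hc)
      omega
    have := Finset.card_le_card hsub
    rw [Fin.card_Ioi] at this
    have := Fin.val_rev i
    have := i.isLt
    omega

lemma Hmem_iff (n : ℕ) (h : Fin n → ℕ) (hmono : Monotone h) (M : Matrix (Fin n) (Fin n) ℂ) :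
    Hmem n (htr n h) (Wm n * Mᵀ * Wm n) ↔ Hmem n h M := by
  unfold Hmem
  simp only [mul_Wm, Wm_mul, Matrix.transpose_apply, htr_iff n h hmono]
  constructor
  · intro H i j hij
    have := H (Fin.rev j) (Fin.rev i)
    simp only [Fin.rev_rev] at this
    exact this hij
  · intro H i j hij
    exact H _ _ hij

lemma image_coset (n : ℕ) (h₁ h₂ : Fin n → ℕ) (S X : Matrix (Fin n) (Fin n) ℂ)
    (hS : IsUnit S.det) (hSt : Sᵀ = S)
    (H : ∀ g ∈ hessSet n h₁ X, phi n S g ∈ hessSet n h₂ X)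
    (T : Set (Matrix (Fin n) (Fin n) ℂ)) (hT : T ∈ cosets n h₁ X) :
    phi n S '' T ∈ cosets n h₂ X := by
  obtain ⟨g, hg, rfl⟩ := hT
  refine ⟨phi n S g, H g hg, ?_⟩
  ext x
  constructor
  · rintro ⟨_, ⟨b, hb, rfl⟩, rfl⟩
    exact ⟨_, phi_one_B n b hb, phi_mul n S g b⟩
  · rintro ⟨b, hb, rfl⟩
    have hgd := phi_det n S g hS hg.1
    refine ⟨phi n S (phi n S g * b), ⟨Wm n * (b⁻¹)ᵀ * Wm n, phi_one_B n b hb, ?_⟩, ?_⟩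
    · rw [phi_mul, phi_phi n S g hS hSt hg.1]
    · apply phi_phi n S _ hS hSt
      rw [Matrix.det_mul]
      exact hgd.mul hb.1

lemma image_image_coset (n : ℕ) (h : Fin n → ℕ) (S X : Matrix (Fin n) (Fin n) ℂ)
    (hS : IsUnit S.det) (hSt : Sᵀ = S)
    (T : Set (Matrix (Fin n) (Fin n) ℂ)) (hT : T ∈ cosets n h X) :
    phi n S '' (phi n S '' T) = T := by
  obtain ⟨g, hg, rfl⟩ := hT
  rw [Set.image_image]
  have : Set.EqOn (fun x => phi n S (phi n S x)) id {g' | ∃ b ∈ Bset n, g' = g * b} := by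
    rintro _ ⟨b, hb, rfl⟩
    apply phi_phi n S _ hS hSt
    rw [Matrix.det_mul]
    exact hg.1.mul hb.1
  rw [this.image_eq, Set.image_id]

theorem stmt6 (n : ℕ) (hn : 0 < n) (h : Fin n → ℕ)
    (hub : ∀ j : Fin n, (j : ℕ) + 1 ≤ h j) (hlb : ∀ j : Fin n, h j ≤ n)
    (hmono : Monotone h) (X : Matrix (Fin n) (Fin n) ℂ)
    (hdiag : ∃ p : Matrix (Fin n) (Fin n) ℂ, IsUnit p.det ∧
      ∃ d : Fin n → ℂ, p⁻¹ * X * p = Matrix.diagonal d) :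
    Nonempty (cosets n h X ≃ cosets n (htr n h) X) := by
  obtain ⟨p, hp, d, hd⟩ := hdiag
  have hX : X = p * Matrix.diagonal d * p⁻¹ := by
    rw [← hd]
    simp only [Matrix.mul_assoc]
    rw [Matrix.mul_nonsing_inv _ hp, Matrix.mul_one, Matrix.mul_nonsing_inv_cancel_left _ _ hp]
  have hS : IsUnit (p * pᵀ).det := by
    rw [Matrix.det_mul, Matrix.det_transpose]
    exact hp.mul hp
  have hSt : (p * pᵀ)ᵀ = p * pᵀ := by simp
  have hXp : X * p = p * Matrix.diagonal d := by
    rw [hX, Matrix.mul_assoc, Matrix.nonsing_inv_mul _ hp, Matrix.mul_one]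
  have hXS : X * (p * pᵀ) = (p * pᵀ) * Xᵀ := by
    rw [Matrix.mul_assoc p, ← Matrix.transpose_mul, ← Matrix.mul_assoc, hXp,
      Matrix.transpose_mul, Matrix.diagonal_transpose, Matrix.mul_assoc]
  generalize p * pᵀ = S at hS hSt hXS
  have H₁ : ∀ g ∈ hessSet n h X, phi n S g ∈ hessSet n (htr n h) X := by
    rintro g ⟨hg, hm⟩
    refine ⟨phi_det n S g hS hg, ?_⟩
    rw [phi_conj n S X g hS hXS hg, Hmem_iff n h hmono]
    exact hm
  have H₂ : ∀ g ∈ hessSet n (htr n h) X, phi n S g ∈ hessSet n h X := by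
    rintro g ⟨hg, hm⟩
    have hg' := phi_det n S g hS hg
    refine ⟨hg', ?_⟩
    rw [← Hmem_iff n h hmono, ← phi_conj n S X _ hS hXS hg', phi_phi n S g hS hSt hg]
    exact hm
  exact ⟨{
    toFun := fun T => ⟨phi n S '' T.1, image_coset n _ _ S X hS hSt H₁ T.1 T.2⟩
    invFun := fun T => ⟨phi n S '' T.1, image_coset n _ _ S X hS hSt H₂ T.1 T.2⟩
    left_inv := fun T => Subtype.ext (image_image_coset n _ S X hS hSt T.1 T.2)
    right_inv := fun T => Subtype.ext (image_image_coset n _ S X hS hSt T.1 T.2) }⟩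

end Stmt6
end

section
/- Let n ≥ 2 and 1 ≤ m ≤ n, and let h' be the Hessenberg function with h'(i) = n−1 for i ≤ n−m and h'(i) = n for i > n−m. For 1 ≤ k ≤ n define tuples of polynomials indexed by w ∈ S_n: x_k(w) = t_{w(k)}, and y_k(w) = ∏_{ℓ=n−m+1}^{n−1}(t_k − t_{w(ℓ)}) if w(n) = k, and y_k(w) = 0 if w(n) ≠ k, all in ℤ[t_1,…,t_n]. Then for every w ∈ S_n and every pair i < j with j ≤ h'(i), setting w' = w∘(i j) (the composition of w with the transposition of i and j), the polynomial t_{w(i)} − t_{w(j)} divides both x_k(w) − x_k(w') and y_k(w) − y_k(w') for every 1 ≤ k ≤ n. -/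
/-!
STATEMENT 7: For h' = ((n-1)^{n-m}, n^m), the tuples x_k and y_k (indexed by
w ∈ S_n) satisfy the GKM divisibility condition: for i < j ≤ h'(i) and
w' = w ∘ (i j), the polynomial t_{w(i)} - t_{w(j)} divides x_k(w) - x_k(w')
and y_k(w) - y_k(w').

Conventions: indices are 0-based, the 1-based value of `i : Fin n` is
`(i : ℕ) + 1`; h' takes 1-based values; `t_i` is `MvPolynomial.X i`; permutation
composition `w ∘ (i j)` is `w * Equiv.swap i j`.
-/

open MvPolynomial

namespace Stmt7

/-- The Hessenberg function h' = ((n-1)^{n-m}, n^m) in 0-indexed form,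
with 1-based values. -/
def hFun (n m : ℕ) : Fin n → ℕ := fun i => if (i : ℕ) < n - m then n - 1 else n

/-- The class x_k: x_k(w) = t_{w(k)}. -/
noncomputable def xk (n : ℕ) (k : Fin n) :
    Equiv.Perm (Fin n) → MvPolynomial (Fin n) ℤ :=
  fun w => X (w k)

/-- The class y_k: y_k(w) = ∏_{ℓ=n-m+1}^{n-1} (t_k - t_{w(ℓ)}) if w(n) = k,
and 0 otherwise (the product is over 0-indexed ℓ with n-m ≤ ℓ < n-1). -/
noncomputable def yk (n m : ℕ) (hn : 0 < n) (k : Fin n) :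
    Equiv.Perm (Fin n) → MvPolynomial (Fin n) ℤ :=
  fun w =>
    if w ⟨n - 1, by omega⟩ = k then
      ∏ ℓ ∈ Finset.univ.filter (fun ℓ : Fin n => n - m ≤ (ℓ : ℕ) ∧ (ℓ : ℕ) < n - 1),
        (X k - X (w ℓ))
    else 0

lemma dvd_swap {n : ℕ} (w : Equiv.Perm (Fin n)) (i j a : Fin n) :
    (X (w i) - X (w j) : MvPolynomial (Fin n) ℤ) ∣
      X (w a) - X ((w * Equiv.swap i j) a) := by
  rw [Equiv.Perm.mul_apply]
  by_cases h1 : a = i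
  · subst h1; rw [Equiv.swap_apply_left]
  · by_cases h2 : a = j
    · subst h2; rw [Equiv.swap_apply_right, ← neg_sub, neg_dvd]
    · rw [Equiv.swap_apply_of_ne_of_ne h1 h2, sub_self]; exact dvd_zero _

lemma dvd_prod_sub {R ι : Type*} [CommRing R] (d : R) (s : Finset ι) (f g : ι → R)
    (h : ∀ a ∈ s, d ∣ f a - g a) : d ∣ ∏ a ∈ s, f a - ∏ a ∈ s, g a := by
  rw [← Ideal.mem_span_singleton, ← Ideal.Quotient.eq, map_prod, map_prod]
  refine Finset.prod_congr rfl fun a ha => ?_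
  rw [Ideal.Quotient.eq, Ideal.mem_span_singleton]
  exact h a ha

theorem stmt7 (n m : ℕ) (hn : 2 ≤ n) (hm : 1 ≤ m) (hmn : m ≤ n)
    (w : Equiv.Perm (Fin n)) (i j : Fin n) (hij : i < j)
    (hh : (j : ℕ) + 1 ≤ hFun n m i) (k : Fin n) :
    (X (w i) - X (w j) : MvPolynomial (Fin n) ℤ) ∣
        (xk n k w - xk n k (w * Equiv.swap i j)) ∧
    (X (w i) - X (w j) : MvPolynomial (Fin n) ℤ) ∣
        (yk n m (by omega) k w - yk n m (by omega) k (w * Equiv.swap i j)) := by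
  refine ⟨dvd_swap w i j k, ?_⟩
  have hij' : (i : ℕ) < j := hij
  have hjn := j.isLt
  by_cases hj : (j : ℕ) = n - 1
  · have hi : n - m ≤ (i : ℕ) := by
      unfold hFun at hh
      split_ifs at hh <;> omega
    have hjl : (⟨n - 1, by omega⟩ : Fin n) = j := Fin.ext hj.symm
    have hmem : i ∈ Finset.univ.filter
        (fun ℓ : Fin n => n - m ≤ (ℓ : ℕ) ∧ (ℓ : ℕ) < n - 1) := by
      simp only [Finset.mem_filter, Finset.mem_univ, true_and]
      omega
    unfold yk
    simp only [hjl]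
    apply dvd_sub
    · split_ifs with h
      · refine Dvd.dvd.trans ?_ (Finset.dvd_prod_of_mem _ hmem)
        rw [← h, ← neg_sub, neg_dvd]
      · exact dvd_zero _
    · split_ifs with h
      · refine Dvd.dvd.trans ?_ (Finset.dvd_prod_of_mem _ hmem)
        rw [← h]
        simp
      · exact dvd_zero _
  · have hl : (w * Equiv.swap i j) ⟨n - 1, by omega⟩ = w ⟨n - 1, by omega⟩ := by
      rw [Equiv.Perm.mul_apply, Equiv.swap_apply_of_ne_of_ne]
      · intro h; have := congrArg Fin.val h; simp only at this; omega
      · intro h; have := congrArg Fin.val h; simp only at this; omega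
    unfold yk
    simp only [hl]
    split_ifs with h
    · apply dvd_prod_sub
      intro a _
      rw [sub_sub_sub_cancel_left, dvd_sub_comm]
      exact dvd_swap w i j a
    · simp

end Stmt7
end

section
/- Let n ≥ 2 and 1 ≤ m ≤ n. In the product ring ∏_{w ∈ S_n} ℤ[t_1,…,t_n] (with pointwise operations), define for 1 ≤ k ≤ n the tuples t_k (the constant tuple with value t_k), x_k (with x_k(w) = t_{w(k)}), and y_k (with y_k(w) = ∏_{ℓ=n−m+1}^{n−1}(t_k − t_{w(ℓ)}) if w(n) = k and y_k(w) = 0 otherwise). Then: (1) y_k · y_{k'} = 0 for all k ≠ k'; (2) x_n · y_k = t_k · y_k for all k; (3) y_k · ∏_{ℓ=1}^{n−m}(t_k − x_ℓ) = ∏_{ℓ=1}^{n−1}(t_k − x_ℓ) for all k; and (4) ∑_{k=1}^{n} y_k = ∏_{ℓ=n−m+1}^{n−1}(x_n − x_ℓ). -/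
/-!
STATEMENT 8: The Abe–Horiguchi–Masuda-type relations for h' = ((n-1)^{n-m}, n^m)
among the tuples t_k, x_k, y_k in the product ring ∏_{w ∈ S_n} ℤ[t_1,…,t_n]:
(1) y_k y_{k'} = 0 for k ≠ k'; (2) x_n y_k = t_k y_k;
(3) y_k ∏_{ℓ=1}^{n-m}(t_k - x_ℓ) = ∏_{ℓ=1}^{n-1}(t_k - x_ℓ);
(4) ∑_k y_k = ∏_{ℓ=n-m+1}^{n-1}(x_n - x_ℓ).

Conventions: 0-based indices; the 1-based value of `i : Fin n` is `(i:ℕ)+1`;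
`t_i` is `MvPolynomial.X i`.
-/

open MvPolynomial

namespace Stmt8

/-- The product ring ∏_{w ∈ S_n} ℤ[t_1,…,t_n] with pointwise operations. -/
abbrev PR (n : ℕ) := Equiv.Perm (Fin n) → MvPolynomial (Fin n) ℤ

/-- The constant tuple t_k. -/
noncomputable def tk (n : ℕ) (k : Fin n) : PR n := fun _ => X k

/-- The tuple x_k: x_k(w) = t_{w(k)}. -/
noncomputable def xk (n : ℕ) (k : Fin n) : PR n := fun w => X (w k)

/-- The tuple y_k: y_k(w) = ∏_{ℓ=n-m+1}^{n-1} (t_k - t_{w(ℓ)}) if w(n) = k,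
and 0 otherwise (0-indexed: product over n-m ≤ ℓ < n-1). -/
noncomputable def yk (n m : ℕ) (hn : 0 < n) (k : Fin n) : PR n :=
  fun w =>
    if w ⟨n - 1, by omega⟩ = k then
      ∏ ℓ ∈ Finset.univ.filter (fun ℓ : Fin n => n - m ≤ (ℓ : ℕ) ∧ (ℓ : ℕ) < n - 1),
        (X k - X (w ℓ))
    else 0

theorem stmt8 (n m : ℕ) (hn : 2 ≤ n) (hm : 1 ≤ m) (hmn : m ≤ n) :
    (∀ k k' : Fin n, k ≠ k' → yk n m (by omega) k * yk n m (by omega) k' = 0) ∧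
    (∀ k : Fin n, xk n ⟨n - 1, by omega⟩ * yk n m (by omega) k
        = tk n k * yk n m (by omega) k) ∧
    (∀ k : Fin n,
      yk n m (by omega) k *
          ∏ ℓ ∈ Finset.univ.filter (fun ℓ : Fin n => (ℓ : ℕ) < n - m), (tk n k - xk n ℓ)
        = ∏ ℓ ∈ Finset.univ.filter (fun ℓ : Fin n => (ℓ : ℕ) < n - 1), (tk n k - xk n ℓ)) ∧
    (∑ k : Fin n, yk n m (by omega) k
        = ∏ ℓ ∈ Finset.univ.filter (fun ℓ : Fin n => n - m ≤ (ℓ : ℕ) ∧ (ℓ : ℕ) < n - 1),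
            (xk n ⟨n - 1, by omega⟩ - xk n ℓ)) := by
  refine ⟨fun k k' h => ?_, fun k => ?_, fun k => ?_, ?_⟩
  · funext w
    simp only [yk, Pi.mul_apply, Pi.zero_apply]
    by_cases h1 : w ⟨n - 1, by omega⟩ = k
    · rw [if_neg (fun h2 => h (h1.symm.trans h2)), mul_zero]
    · rw [if_neg h1, zero_mul]
  · funext w
    simp only [yk, xk, tk, Pi.mul_apply]
    split_ifs with h1
    · rw [h1]
    · simp
  · funext w
    simp only [yk, xk, tk, Pi.mul_apply, Finset.prod_apply, Pi.sub_apply]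
    split_ifs with h1
    · rw [← Finset.prod_union]
      · congr 1
        ext l
        simp only [Finset.mem_union, Finset.mem_filter, Finset.mem_univ, true_and]
        omega
      · rw [Finset.disjoint_left]
        intro l
        simp only [Finset.mem_filter, Finset.mem_univ, true_and]
        omega
    · rw [zero_mul, eq_comm]
      apply Finset.prod_eq_zero (i := w.symm k)
      · simp only [Finset.mem_filter, Finset.mem_univ, true_and]
        have h2 : ((w.symm k : Fin n) : ℕ) ≠ n - 1 := by
          intro h3
          apply h1
          rw [← Equiv.eq_symm_apply]
          exact Fin.ext h3.symm
        have := (w.symm k).isLt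
        omega
      · simp
  · funext w
    simp only [yk, xk, Finset.sum_apply, Finset.prod_apply, Pi.sub_apply]
    rw [Finset.sum_ite_eq]
    simp

end Stmt8
end

section
/- Let n ≥ 2 and 1 ≤ m ≤ n, and let h' be the Hessenberg function with h'(i) = n−1 for i ≤ n−m and h'(i) = n for i > n−m. Let R be the subring of ∏_{w ∈ S_n} ℤ[t_1,…,t_n] consisting of tuples α such that t_{w(i)} − t_{w(j)} divides α(w) − α(w∘(i j)) whenever 1 ≤ i < j ≤ h'(i). Then R is generated as a ℤ-algebra by the 3n elements t_k, x_k, y_k (1 ≤ k ≤ n), where t_k is the constant tuple with value t_k, x_k(w) = t_{w(k)}, and y_k(w) = ∏_{ℓ=n−m+1}^{n−1}(t_k − t_{w(ℓ)}) if w(n) = k and 0 otherwise. -/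
/-!
STATEMENT 9: For h' = ((n-1)^{n-m}, n^m), the GKM ring R (the subset of
∏_{w ∈ S_n} ℤ[t_1,…,t_n] cut out by the divisibility conditions) is generated
as a ℤ-algebra by the 3n elements t_k, x_k, y_k (1 ≤ k ≤ n).  We state this as:
the GKM subset coincides with the ℤ-subalgebra generated by these elements.

Conventions: 0-based indices; the 1-based value of `i : Fin n` is `(i:ℕ)+1`;
h' takes 1-based values; `w ∘ (i j)` is `w * Equiv.swap i j`.
-/

open MvPolynomial

namespace Stmt9

abbrev PR (n : ℕ) := Equiv.Perm (Fin n) → MvPolynomial (Fin n) ℤ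

/-- The Hessenberg function h' = ((n-1)^{n-m}, n^m), with 1-based values. -/
def hFun (n m : ℕ) : Fin n → ℕ := fun i => if (i : ℕ) < n - m then n - 1 else n

/-- The GKM subset: tuples α with t_{w(i)} - t_{w(j)} dividing
α(w) - α(w ∘ (i j)) whenever i < j ≤ h'(i). -/
def gkmSet (n m : ℕ) : Set (PR n) :=
  {α | ∀ w : Equiv.Perm (Fin n), ∀ i j : Fin n, i < j → (j : ℕ) + 1 ≤ hFun n m i →
    (X (w i) - X (w j) : MvPolynomial (Fin n) ℤ) ∣ (α w - α (w * Equiv.swap i j))}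

/-- The constant tuple t_k. -/
noncomputable def tk (n : ℕ) (k : Fin n) : PR n := fun _ => X k

/-- The tuple x_k: x_k(w) = t_{w(k)}. -/
noncomputable def xk (n : ℕ) (k : Fin n) : PR n := fun w => X (w k)

/-- The tuple y_k: y_k(w) = ∏_{ℓ=n-m+1}^{n-1} (t_k - t_{w(ℓ)}) if w(n) = k,
and 0 otherwise. -/
noncomputable def yk (n m : ℕ) (hn : 0 < n) (k : Fin n) : PR n :=
  fun w =>
    if w ⟨n - 1, by omega⟩ = k then
      ∏ ℓ ∈ Finset.univ.filter (fun ℓ : Fin n => n - m ≤ (ℓ : ℕ) ∧ (ℓ : ℕ) < n - 1),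
        (X k - X (w ℓ))
    else 0


section prelim
variable {n : ℕ}

/-- substitution t_a := t_b -/
noncomputable def sub (a b : Fin n) : MvPolynomial (Fin n) ℤ →ₐ[ℤ] MvPolynomial (Fin n) ℤ :=
  aeval (fun c => if c = a then X b else X c)

lemma sub_X (a b c : Fin n) : sub a b (X c) = if c = a then X b else X c := by
  simp [sub]

lemma dvd_sub_sub (a b : Fin n) (p : MvPolynomial (Fin n) ℤ) :
    (X a - X b) ∣ p - sub a b p := by
  induction p using MvPolynomial.induction_on with
  | C z => simp [sub]
  | add p q hp hq =>
    have : p + q - sub a b (p + q) = (p - sub a b p) + (q - sub a b q) := by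
      rw [map_add]; ring
    rw [this]; exact dvd_add hp hq
  | mul_X p c hp =>
    have : p * X c - sub a b (p * X c)
        = (p - sub a b p) * X c + sub a b p * (X c - sub a b (X c)) := by
      rw [map_mul]; ring
    rw [this]
    refine dvd_add (Dvd.dvd.mul_right hp _) (Dvd.dvd.mul_left ?_ _)
    rw [sub_X]
    split_ifs with h
    · subst h; exact dvd_rfl
    · simp

lemma dvd_iff_sub (a b : Fin n) (p : MvPolynomial (Fin n) ℤ) :
    (X a - X b) ∣ p ↔ sub a b p = 0 := by
  constructor
  · rintro ⟨q, rfl⟩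
    rw [map_mul, map_sub, sub_X, sub_X]
    split_ifs <;> simp_all
  · intro h
    have := dvd_sub_sub a b p
    rwa [h, sub_zero] at this

lemma X_sub_X_ne {a b : Fin n} (h : a ≠ b) : (X a - X b : MvPolynomial (Fin n) ℤ) ≠ 0 := by
  intro h'
  exact h (MvPolynomial.X_injective (sub_eq_zero.1 h'))

lemma X_sub_X_prime {a b : Fin n} (h : a ≠ b) :
    Prime (X a - X b : MvPolynomial (Fin n) ℤ) := by
  refine ⟨X_sub_X_ne h, ?_, ?_⟩
  · intro hu
    have h1 : (X a - X b : MvPolynomial (Fin n) ℤ) ∣ 1 := isUnit_iff_dvd_one.1 hu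
    rw [dvd_iff_sub, map_one] at h1
    exact one_ne_zero h1
  · intro p q hpq
    rw [dvd_iff_sub, map_mul, mul_eq_zero] at hpq
    rwa [dvd_iff_sub, dvd_iff_sub]

lemma relPrime_X {a b c d : Fin n} (hab : a ≠ b) (hcd : c ≠ d) (h1 : ¬ (a = c ∧ b = d))
    (h2 : ¬ (a = d ∧ b = c)) :
    IsRelPrime (X a - X b : MvPolynomial (Fin n) ℤ) (X c - X d) := by
  rw [(X_sub_X_prime hab).irreducible.isRelPrime_iff_not_dvd, dvd_iff_sub, map_sub, sub_X, sub_X]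
  split_ifs with h3 h4 h4
  · exact absurd (h3.trans h4.symm) hcd
  · exact X_sub_X_ne (fun h => h1 ⟨h3.symm, h⟩)
  · exact X_sub_X_ne (fun h => h2 ⟨h4.symm, h.symm⟩)
  · exact X_sub_X_ne hcd

/-- evaluation at a permutation -/
noncomputable def ev (w : Equiv.Perm (Fin n)) :
    MvPolynomial (Fin n ⊕ Fin n) ℤ →ₐ[ℤ] MvPolynomial (Fin n) ℤ :=
  aeval (Sum.elim (fun k => X k) (fun k => X (w k)))

/-- the variable t_k -/
noncomputable def tt (k : Fin n) : MvPolynomial (Fin n ⊕ Fin n) ℤ := X (Sum.inl k)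
/-- the variable x_k -/
noncomputable def xx (k : Fin n) : MvPolynomial (Fin n ⊕ Fin n) ℤ := X (Sum.inr k)

@[simp] lemma ev_tt (w : Equiv.Perm (Fin n)) (k : Fin n) : ev w (tt k) = X k := by
  simp [ev, tt]
@[simp] lemma ev_xx (w : Equiv.Perm (Fin n)) (k : Fin n) : ev w (xx k) = X (w k) := by
  simp [ev, xx]

lemma ev_gkm (w : Equiv.Perm (Fin n)) (a b : Fin n) (p : MvPolynomial (Fin n ⊕ Fin n) ℤ) :
    (X (w a) - X (w b)) ∣ ev w p - ev (w * Equiv.swap a b) p := by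
  rw [dvd_iff_sub, map_sub, sub_eq_zero]
  have : (sub (w a) (w b)).comp (ev w) = (sub (w a) (w b)).comp (ev (w * Equiv.swap a b)) := by
    apply MvPolynomial.algHom_ext
    rintro (k | k)
    · simp [ev]
    · simp only [ev, AlgHom.comp_apply, aeval_X, Sum.elim_inr, Equiv.Perm.mul_apply, sub_X]
      rw [Equiv.swap_apply_def]
      split_ifs <;> simp_all
  exact DFunLike.congr_fun this p

/-- agreement on P -/
def Co (P : Finset (Fin n)) (w0 w : Equiv.Perm (Fin n)) : Prop := ∀ p ∈ P, w p = w0 p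

/-- GKM on a coset -/
def GK (P : Finset (Fin n)) (w0 : Equiv.Perm (Fin n)) (f : PR n) : Prop :=
  ∀ w, Co P w0 w → ∀ a b, a ∉ P → b ∉ P → a ≠ b →
    (X (w a) - X (w b)) ∣ f w - f (w * Equiv.swap a b)

lemma Co.swap {P : Finset (Fin n)} {w0 w : Equiv.Perm (Fin n)} (h : Co P w0 w) {a b : Fin n}
    (ha : a ∉ P) (hb : b ∉ P) : Co P w0 (w * Equiv.swap a b) := by
  intro p hp
  rw [Equiv.Perm.mul_apply, Equiv.swap_apply_of_ne_of_ne, h p hp]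
  · rintro rfl; exact ha hp
  · rintro rfl; exact hb hp

lemma Co.notMem {P : Finset (Fin n)} {w0 w : Equiv.Perm (Fin n)} (h : Co P w0 w) {a : Fin n} :
    w a ∉ P.image w0 ↔ a ∉ P := by
  rw [not_iff_not, Finset.mem_image]
  constructor
  · rintro ⟨p, hp, e⟩
    rw [← h p hp] at e
    rwa [← w.injective e]
  · intro ha
    exact ⟨a, ha, (h a ha).symm⟩

/-- values used before K -/
def before (P : Finset (Fin n)) (w0 : Equiv.Perm (Fin n)) (K : Fin n) : Finset (Fin n) :=
  Finset.univ.filter (fun j => j < K ∧ j ∉ P.image w0)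

lemma newton (P : Finset (Fin n)) (w0 : Equiv.Perm (Fin n)) (i : Fin n) (hi : i ∉ P)
    (IH : ∀ w1, Co P w0 w1 → ∀ g, GK (insert i P) w1 g →
      ∃ p, ∀ w, Co (insert i P) w1 w → g w = ev w p)
    (I : Ideal (MvPolynomial (Fin n ⊕ Fin n) ℤ)) (d : Fin n → MvPolynomial (Fin n) ℤ)
    (hdI : ∀ p ∈ I, ∀ w, Co P w0 w → d (w i) ∣ ev w p)
    (E : Fin n → MvPolynomial (Fin n ⊕ Fin n) ℤ) (hE : ∀ K, E K ∈ I)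
    (hE0 : ∀ K w, Co P w0 w → w i < K → ev w (E K) = 0)
    (hE1 : ∀ w, Co P w0 w → ev w (E (w i)) = d (w i) * ∏ j ∈ before P w0 (w i), (X (w i) - X j))
    (hd : ∀ K a b, a ∉ P.image w0 → b ∉ P.image w0 → a ≠ b → IsRelPrime (d K) (X a - X b))
    (f : PR n) (hf : GK P w0 f) (hdf : ∀ w, Co P w0 w → d (w i) ∣ f w) :
    ∃ p ∈ I, ∀ w, Co P w0 w → f w = ev w p := by
  have key : ∀ k : ℕ, k ≤ n → ∃ p ∈ I, ∀ w, Co P w0 w → (w i : ℕ) < k → f w = ev w p := by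
    intro k
    induction k with
    | zero => intro _; exact ⟨0, I.zero_mem, fun w _ h => absurd h (Nat.not_lt_zero _)⟩
    | succ k ih =>
      intro hk
      obtain ⟨p, hpI, hp⟩ := ih (by omega)
      set K : Fin n := ⟨k, by omega⟩ with hK
      by_cases hex : ∃ w1, Co P w0 w1 ∧ w1 i = K
      swap
      · refine ⟨p, hpI, fun w hw hlt => hp w hw ?_⟩
        have : w i ≠ K := fun h => hex ⟨w, hw, h⟩
        have : (w i : ℕ) ≠ k := fun h => this (Fin.ext h)
        omega
      obtain ⟨w1, hw1, hw1i⟩ := hex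
      -- the element e
      set e : MvPolynomial (Fin n) ℤ := d K * ∏ j ∈ before P w0 K, (X K - X j) with he
      have hKim : K ∉ P.image w0 := by rw [← hw1i]; exact hw1.notMem.2 hi
      have hbef : ∀ j ∈ before P w0 K, j ≠ K ∧ j ∉ P.image w0 := by
        intro j hj
        simp only [before, Finset.mem_filter, Finset.mem_univ, true_and] at hj
        exact ⟨hj.1.ne, hj.2⟩
      have hco : ∀ w, Co (insert i P) w1 w → Co P w0 w ∧ w i = K := by
        intro w hw
        refine ⟨fun q hq => ?_, ?_⟩
        · rw [hw q (Finset.mem_insert_of_mem hq), hw1 q hq]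
        · rw [hw i (Finset.mem_insert_self _ _), hw1i]
      have hco' : ∀ w, Co P w0 w → w i = K → Co (insert i P) w1 w := by
        intro w hw hwi q hq
        rcases Finset.mem_insert.1 hq with rfl | hq
        · rw [hwi, hw1i]
        · rw [hw q hq, hw1 q hq]
      have hdiv : ∀ w, Co (insert i P) w1 w → e ∣ f w - ev w p := by
        intro w hw
        obtain ⟨hw', hwi⟩ := hco w hw
        refine IsRelPrime.mul_dvd ?_ ?_ ?_
        · refine IsRelPrime.prod_right fun j hj => ?_
          exact hd K K j hKim (hbef j hj).2 (hbef j hj).1.symm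
        · rw [← hwi]
          exact dvd_sub (hdf w hw') (hdI p hpI w hw')
        · refine Finset.prod_dvd_of_isRelPrime ?_ ?_
          · intro a ha b hb hab
            refine relPrime_X (hbef a ha).1.symm (hbef b hb).1.symm (fun h => hab h.2) ?_
            exact fun h => (hbef b hb).1 h.1.symm
          · intro j hj
            have hj' := hbef j hj
            have hjlt : j < K := by
              simp only [before, Finset.mem_filter, Finset.mem_univ, true_and] at hj
              exact hj.1
            set b := w.symm j with hb
            have hwb : w b = j := by simp [hb]
            have hbP : b ∉ P := by rw [← hw'.notMem, hwb]; exact hj'.2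
            have hib : i ≠ b := by
              intro h; rw [← h, hwi] at hwb; exact hj'.1 hwb.symm
            have h1 := hf w hw' i b hi hbP hib
            have h2 := ev_gkm w i b p
            have h3 : f (w * Equiv.swap i b) = ev (w * Equiv.swap i b) p := by
              refine hp _ (hw'.swap hi hbP) ?_
              simp only [Equiv.Perm.mul_apply, Equiv.swap_apply_left, hwb]
              exact hjlt
            rw [hwi, hwb] at h1 h2
            have h4 := dvd_sub h1 h2
            rw [h3] at h4
            simpa using h4
      choose! g hg using hdiv
      have hGK : GK (insert i P) w1 g := by
        intro w hw a b ha hb hab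
        obtain ⟨hw', hwi⟩ := hco w hw
        rw [Finset.mem_insert, not_or] at ha hb
        have haK : w a ≠ K := by rw [← hwi]; exact fun h => ha.1 (w.injective h)
        have hbK : w b ≠ K := by rw [← hwi]; exact fun h => hb.1 (w.injective h)
        have hwab : w a ≠ w b := fun h => hab (w.injective h)
        have hsw := Co.swap hw (a := a) (b := b) (by simp [ha]) (by simp [hb])
        have h1 : (X (w a) - X (w b)) ∣ e * (g w - g (w * Equiv.swap a b)) := by
          rw [mul_sub, ← hg w hw, ← hg _ hsw]
          have := dvd_sub (hf w hw' a b ha.2 hb.2 hab) (ev_gkm w a b p)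
          convert this using 1
          ring
        refine IsRelPrime.dvd_of_dvd_mul_left ?_ h1
        refine IsRelPrime.mul_right ?_ ?_
        · exact (hd K _ _ (hw'.notMem.2 ha.2) (hw'.notMem.2 hb.2) hwab).symm
        · refine IsRelPrime.prod_right fun j hj => ?_
          refine relPrime_X hwab (hbef j hj).1.symm (fun h => haK h.1) (fun h => hbK h.2)
      obtain ⟨q, hq⟩ := IH w1 hw1 g hGK
      refine ⟨p + q * E K, I.add_mem hpI (I.mul_mem_left _ (hE K)), fun w hw hlt => ?_⟩
      rw [map_add, map_mul]
      rcases Nat.lt_succ_iff_lt_or_eq.1 hlt with h | h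
      · rw [hE0 K w hw h, mul_zero, add_zero, hp w hw h]
      · have hwi : w i = K := Fin.ext h
        have h1 := hE1 w hw
        rw [hwi] at h1
        rw [h1, ← hq w (hco' w hw hwi), ← he, mul_comm, ← hg w (hco' w hw hwi)]
        ring
  obtain ⟨p, hpI, hp⟩ := key n le_rfl
  exact ⟨p, hpI, fun w hw => hp w hw (w i).2⟩

lemma classical_gkm : ∀ (N : ℕ) (P : Finset (Fin n)), Pᶜ.card = N → ∀ (w0 : Equiv.Perm (Fin n))
    (f : PR n), GK P w0 f → ∃ p, ∀ w, Co P w0 w → f w = ev w p := by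
  intro N
  induction N with
  | zero =>
    intro P hP w0 f _
    have hP' : P = Finset.univ := by
      rw [Finset.card_eq_zero] at hP
      simpa using hP
    refine ⟨rename Sum.inl (f w0), fun w hw => ?_⟩
    have : w = w0 := by
      ext1 q; exact hw q (by simp [hP'])
    subst this
    rw [ev, aeval_rename]
    have : (Sum.elim (fun k => X k) (fun k => X (w k)) ∘ Sum.inl
      : Fin n → MvPolynomial (Fin n) ℤ) = X := rfl
    rw [this]
    simp
  | succ N ih =>
    intro P hP w0 f hf
    have hne : Pᶜ.Nonempty := by rw [← Finset.card_pos]; omega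
    obtain ⟨i, hi⟩ := hne
    have hi' : i ∉ P := by simpa using hi
    have hcard : ((insert i P)ᶜ).card = N := by
      rw [Finset.card_compl] at hP ⊢
      rw [Finset.card_insert_of_notMem hi']
      omega
    obtain ⟨p, _, hp⟩ := newton P w0 i hi' (fun w1 _ g hg => ih _ hcard w1 g hg) ⊤ (fun _ => 1)
      (fun _ _ _ _ => one_dvd _) (fun K => ∏ j ∈ before P w0 K, (xx i - tt j))
      (fun _ => trivial)
      (by
        intro K w hw hlt
        rw [map_prod]
        refine Finset.prod_eq_zero (i := w i) ?_ (by simp)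
        simp only [before, Finset.mem_filter, Finset.mem_univ, true_and]
        exact ⟨hlt, hw.notMem.2 hi'⟩)
      (by intro w _; simp [map_prod])
      (fun _ _ _ _ _ _ => isRelPrime_one_left) f hf (fun _ _ => one_dvd _)
    exact ⟨p, hp⟩

lemma prod_sub_mem {ι : Type*} (s : Finset ι) (a b : MvPolynomial (Fin n ⊕ Fin n) ℤ)
    (t : ι → MvPolynomial (Fin n ⊕ Fin n) ℤ) :
    (a - b) ∣ ∏ j ∈ s, (a - t j) - ∏ j ∈ s, (b - t j) := by
  have := Polynomial.sub_dvd_eval_sub a b (∏ j ∈ s, (Polynomial.X - Polynomial.C (t j)))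
  simpa [Polynomial.eval_prod] using this

lemma two_step (l i : Fin n) (hil : i ≠ l) (w0 : Equiv.Perm (Fin n)) (f : PR n)
    (hf : GK {l} w0 f)
    (hfi : ∀ w, w l = w0 l → w i < w0 l → (X (w0 l) - X (w i)) ∣ f w) :
    ∃ a b, ∀ w, w l = w0 l → f w =
      ev w (a * ∏ j ∈ Finset.univ.filter (· < w0 l), (xx l - tt j) + b * (xx l - xx i)) := by
  set k := w0 l with hk
  set Q : MvPolynomial (Fin n ⊕ Fin n) ℤ :=
    ∏ j ∈ Finset.univ.filter (· < k), (xx l - tt j) with hQ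
  have hCo : ∀ w, Co {l} w0 w ↔ w l = k := by intro w; simp [Co, hk]
  have him : ∀ j, j ∉ Finset.image w0 {l} ↔ j ≠ k := by intro j; simp [hk]
  have hmem : ∀ p, p ∈ Ideal.span {Q, xx l - xx i} ↔ ∃ a b, a * Q + b * (xx l - xx i) = p :=
    fun p => Ideal.mem_span_pair
  have hQ2 : ∏ j ∈ Finset.univ.filter (· < k), (xx i - tt j) ∈ Ideal.span {Q, xx l - xx i} := by
    obtain ⟨c, hc⟩ := prod_sub_mem (Finset.univ.filter (· < k)) (xx l) (xx i) tt
    rw [hmem]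
    refine ⟨1, -c, ?_⟩
    linear_combination hc
  obtain ⟨p, hpI, hp⟩ := newton {l} w0 i (by simpa using hil)
    (fun w1 _ g hg => classical_gkm _ _ rfl w1 g hg) (Ideal.span {Q, xx l - xx i})
    (fun K => if K < k then X k - X K else 1)
    (by
      intro p hpI w hw
      rw [hCo] at hw
      split_ifs with h
      · obtain ⟨a, b, rfl⟩ := (hmem p).1 hpI
        rw [map_add, map_mul, map_mul, map_sub, ev_xx, ev_xx, hw, hQ, map_prod]
        refine dvd_add (Dvd.dvd.mul_left ?_ _) (Dvd.dvd.mul_left dvd_rfl _)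
        have := Finset.dvd_prod_of_mem (fun j => ev w (xx l - tt j))
          (show w i ∈ Finset.univ.filter (· < k) by simpa using h)
        simpa [hw] using this
      · exact one_dvd _)
    (fun K => if K < k then (xx l - xx i) * ∏ j ∈ before {l} w0 K, (xx i - tt j)
      else ∏ j ∈ before {l} w0 K, (xx i - tt j))
    (by
      intro K
      split_ifs with h
      · exact Ideal.mul_mem_right _ _ (Ideal.subset_span (by simp))
      · refine Ideal.mem_of_dvd _ ?_ hQ2
        refine Finset.prod_dvd_prod_of_subset _ _ _ ?_
        intro j hj
        simp only [Finset.mem_filter, Finset.mem_univ, true_and] at hj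
        simp only [before, Finset.mem_filter, Finset.mem_univ, true_and, him]
        exact ⟨lt_of_lt_of_le hj (not_lt.1 h), hj.ne⟩)
    (by
      intro K w hw hlt
      have h0 : ev w (∏ j ∈ before {l} w0 K, (xx i - tt j)) = 0 := by
        rw [map_prod]
        refine Finset.prod_eq_zero (i := w i) ?_ (by simp)
        simp only [before, Finset.mem_filter, Finset.mem_univ, true_and]
        exact ⟨hlt, hw.notMem.2 (by simpa using hil)⟩
      split_ifs with h
      · rw [map_mul, h0, mul_zero]
      · exact h0)
    (by
      intro w hw
      rw [hCo] at hw
      split_ifs with h <;> simp [map_prod, hw])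
    (by
      intro K a b ha hb hab
      rw [him] at ha hb
      split_ifs with h
      · exact relPrime_X h.ne' hab (fun h => ha h.1.symm) (fun h => hb h.1.symm)
      · exact isRelPrime_one_left)
    f hf
    (by
      intro w hw
      rw [hCo] at hw
      split_ifs with h
      · exact hfi w hw h
      · exact one_dvd _)
  obtain ⟨a, b, rfl⟩ := (hmem p).1 hpI
  exact ⟨a, b, fun w hw => hp w ((hCo w).2 hw)⟩

lemma two_pos (l i : Fin n) (hil : i ≠ l) (f : PR n)
    (hf : ∀ w a b, a ≠ l → b ≠ l → a ≠ b → (X (w a) - X (w b)) ∣ f w - f (w * Equiv.swap a b))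
    (hfi : ∀ w, (X (w i) - X (w l)) ∣ f w - f (w * Equiv.swap i l)) :
    ∃ q, ∃ r : Fin n → MvPolynomial (Fin n ⊕ Fin n) ℤ, ∀ w,
      f w = ev w q + (X (w l) - X (w i)) * ev w (r (w l)) := by
  have key : ∀ k : ℕ, k ≤ n → ∃ q, ∃ r : Fin n → MvPolynomial (Fin n ⊕ Fin n) ℤ, ∀ w,
      (w l : ℕ) < k → f w = ev w q + (X (w l) - X (w i)) * ev w (r (w l)) := by
    intro k
    induction k with
    | zero => intro _; exact ⟨0, 0, fun w h => absurd h (Nat.not_lt_zero _)⟩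
    | succ k ih =>
      intro hk
      obtain ⟨q, r, hqr⟩ := ih (by omega)
      set K : Fin n := ⟨k, by omega⟩ with hK
      set w0 : Equiv.Perm (Fin n) := Equiv.swap l K with hw0
      have hw0l : w0 l = K := by simp [hw0]
      obtain ⟨a, b, hab⟩ := two_step l i hil w0 (fun w => f w - ev w q)
        (by
          intro w hw a b ha hb hab
          rw [Finset.mem_singleton] at ha hb
          have := dvd_sub (hf w a b ha hb hab) (ev_gkm w a b q)
          convert this using 1
          ring)
        (by
          intro w hw hlt
          rw [hw0l] at hw hlt ⊢
          have h1 := dvd_sub (hfi w) (ev_gkm w i l q)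
          have h2 := hqr (w * Equiv.swap i l) (by
            rw [Equiv.Perm.mul_apply, Equiv.swap_apply_right]; exact hlt)
          simp only [Equiv.Perm.mul_apply, Equiv.swap_apply_left, Equiv.swap_apply_right] at h2
          rw [h2, hw] at h1
          rw [← neg_sub, neg_dvd]
          have h3 := dvd_add h1 (dvd_mul_right (X (w i) - X K)
            (ev (w * Equiv.swap i l) (r (w i))))
          convert h3 using 1
          ring)
      rw [hw0l] at hab
      refine ⟨q + a * ∏ j ∈ Finset.univ.filter (· < K), (xx l - tt j), Function.update r K b, ?_⟩
      intro w hlt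
      rcases Nat.lt_succ_iff_lt_or_eq.1 hlt with h | h
      · have hne : w l ≠ K := fun h' => by rw [h'] at h; exact lt_irrefl _ h
        rw [Function.update_of_ne hne, hqr w h, map_add, map_mul, map_prod,
          Finset.prod_eq_zero (i := w l) (Finset.mem_filter.2 ⟨Finset.mem_univ _, h⟩) (by simp)]
        ring
      · have hwl : w l = K := Fin.ext h
        have h1 := hab w hwl
        rw [map_add, map_mul _ b, map_sub, ev_xx, ev_xx] at h1
        rw [hwl] at h1 ⊢
        rw [Function.update_self, map_add]
        linear_combination h1
  obtain ⟨q, r, h⟩ := key n le_rfl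
  exact ⟨q, r, fun w => h w (w l).2⟩

/-- The block of positions. -/
def blk (n m : ℕ) : Finset (Fin n) :=
  Finset.univ.filter (fun ℓ : Fin n => n - m ≤ (ℓ : ℕ) ∧ (ℓ : ℕ) < n - 1)

/-- The polynomial Y. -/
noncomputable def YY (m : ℕ) (l : Fin n) : MvPolynomial (Fin n ⊕ Fin n) ℤ :=
  ∏ ℓ ∈ blk n m, (xx l - xx ℓ)

lemma structure_thm (l : Fin n) (hl : (l : ℕ) = n - 1) (m : ℕ) (hm : 1 ≤ m) : m ≤ n →
    ∀ α ∈ gkmSet n m, ∃ p, ∃ r : Fin n → MvPolynomial (Fin n ⊕ Fin n) ℤ,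
      ∀ w, α w = ev w p + ev w (YY m l) * ev w (r (w l)) := by
  have base : ∀ m, 1 ≤ m → ∀ α ∈ gkmSet n m, ∀ w a b, a ≠ l → b ≠ l → a ≠ b →
      (X (w a) - X (w b)) ∣ α w - α (w * Equiv.swap a b) := by
    intro m hm α hα w a b ha hb hab
    have ha' : (a : ℕ) ≠ n - 1 := fun h => ha (Fin.ext (h.trans hl.symm))
    have hb' : (b : ℕ) ≠ n - 1 := fun h => hb (Fin.ext (h.trans hl.symm))
    rcases lt_or_gt_of_ne hab with h | h
    · refine hα w a b h ?_
      unfold hFun; split_ifs <;> omega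
    · have := hα w b a h (by unfold hFun; split_ifs <;> omega)
      rw [Equiv.swap_comm, ← neg_sub, neg_dvd]
      exact this
  induction m, hm using Nat.le_induction with
  | base =>
    intro _ α hα
    have h : ∀ k : Fin n, ∃ p, ∀ w, w l = k → α w = ev w p := by
      intro k
      obtain ⟨p, hp⟩ := classical_gkm _ {l} rfl (Equiv.swap l k) α (by
        intro w _ a b ha hb hab
        rw [Finset.mem_singleton] at ha hb
        exact base 1 le_rfl α hα w a b ha hb hab)
      exact ⟨p, fun w hw => hp w (by simp [Co, hw])⟩
    choose r hr using h
    refine ⟨0, r, fun w => ?_⟩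
    have : blk n 1 = ∅ := by
      ext j; simp only [blk, Finset.mem_filter, Finset.mem_univ, true_and, Finset.notMem_empty,
        iff_false]; omega
    rw [hr _ w rfl, YY, this]
    simp
  | succ m hm ih =>
    intro hmn α hα
    obtain ⟨p, r, hpr⟩ := ih (by omega) α (by
      intro w a b hab hb
      refine hα w a b hab ?_
      revert hb
      unfold hFun; split_ifs <;> omega)
    set i : Fin n := ⟨n - (m + 1), by omega⟩ with hi
    have hil : i ≠ l := by
      intro h; have := congrArg Fin.val h; simp only [hi] at this; omega
    have hblk : blk n (m + 1) = insert i (blk n m) := by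
      ext j
      simp only [blk, Finset.mem_filter, Finset.mem_univ, true_and, Finset.mem_insert, Fin.ext_iff,
        hi]
      omega
    have hib : i ∉ blk n m := by
      simp only [blk, Finset.mem_filter, Finset.mem_univ, true_and, hi]
      omega
    obtain ⟨q, s, hqs⟩ := two_pos l i hil (fun w => ev w (r (w l)))
      (by
        intro w a b ha hb hab
        have : (w * Equiv.swap a b) l = w l := by
          rw [Equiv.Perm.mul_apply, Equiv.swap_apply_of_ne_of_ne ha.symm hb.symm]
        rw [this]
        exact ev_gkm w a b _)
      (by
        intro w
        have hwil : w i ≠ w l := fun h => hil (w.injective h)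
        have h1 : (X (w i) - X (w l)) ∣ α w - α (w * Equiv.swap i l) := by
          refine hα w i l ?_ ?_
          · rw [Fin.lt_def, hl]; simp only [hi]; omega
          · unfold hFun
            rw [if_neg (by simp only [hi]; omega)]; omega
        have h2 := ev_gkm w i l p
        have h3 := ev_gkm w i l (YY m l)
        rw [hpr w, hpr (w * Equiv.swap i l)] at h1
        have h4 : (X (w i) - X (w l)) ∣ ev w (YY m l) *
            (ev w (r (w l)) - ev (w * Equiv.swap i l) (r ((w * Equiv.swap i l) l))) := by
          have := dvd_sub (dvd_sub h1 h2) (Dvd.dvd.mul_right h3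
            (ev (w * Equiv.swap i l) (r ((w * Equiv.swap i l) l))))
          convert this using 1
          ring
        refine IsRelPrime.dvd_of_dvd_mul_left ?_ h4
        rw [YY, map_prod]
        refine IsRelPrime.prod_right fun j hj => ?_
        rw [map_sub, ev_xx, ev_xx]
        have hjl : j ≠ l := by
          rintro rfl
          simp only [blk, Finset.mem_filter, Finset.mem_univ, true_and] at hj
          omega
        have hji : j ≠ i := by rintro rfl; exact hib hj
        exact relPrime_X hwil (fun h => hjl (w.injective h.symm)) (fun h => hwil h.1)
          (fun h => hji (w.injective h.1.symm)))
    refine ⟨p + YY m l * q, s, fun w => ?_⟩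
    have hY : YY (m + 1) l = (xx l - xx i) * YY m l := by
      rw [YY, hblk, Finset.prod_insert hib, ← YY]
    have h1 := hqs w
    rw [hpr w, h1, hY]
    simp only [map_add, map_mul, map_sub, ev_xx]
    ring

end prelim

theorem stmt9 (n m : ℕ) (hn : 2 ≤ n) (hm : 1 ≤ m) (hmn : m ≤ n) :
    gkmSet n m =
      (Algebra.adjoin ℤ
        (Set.range (tk n) ∪ Set.range (xk n) ∪
          Set.range (yk n m (by omega))) : Subalgebra ℤ (PR n)) := by
  have hn0 : 0 < n := by omega
  set l : Fin n := ⟨n - 1, by omega⟩ with hl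
  have hyk : ∀ k w, yk n m hn0 k w = if w l = k then ev w (YY m l) else 0 := by
    intro k w
    unfold yk
    split_ifs with h
    · rw [YY, map_prod]
      refine Finset.prod_congr rfl fun j _ => ?_
      rw [map_sub, ev_xx, ev_xx, h]
    · rfl
  apply Set.Subset.antisymm
  · intro α hα
    obtain ⟨p, r, hpr⟩ := structure_thm l rfl m hm hmn α hα
    set A := Algebra.adjoin ℤ (Set.range (tk n) ∪ Set.range (xk n) ∪ Set.range (yk n m hn0))
      with hA
    have hev : ∀ p, (fun w => ev w p : PR n) ∈ A := by
      intro p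
      induction p using MvPolynomial.induction_on with
      | C z =>
        have := A.algebraMap_mem z
        convert this using 1
        ext1 w
        simp [ev]
      | add p q hp hq =>
        convert A.add_mem hp hq using 1
        ext1 w
        simp
      | mul_X p c hp =>
        have hc : (fun w => ev w (X c) : PR n) ∈ A := by
          rcases c with c | c
          · refine Algebra.subset_adjoin (Or.inl (Or.inl ⟨c, ?_⟩))
            ext1 w
            exact (ev_tt w c).symm
          · refine Algebra.subset_adjoin (Or.inl (Or.inr ⟨c, ?_⟩))
            ext1 w
            exact (ev_xx w c).symm
        convert A.mul_mem hp hc using 1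
        ext1 w
        simp
    have hα' : α = (fun w => ev w p : PR n)
        + ∑ k, (fun w => ev w (r k) : PR n) * yk n m hn0 k := by
      ext1 w
      simp only [Pi.add_apply, Finset.sum_apply, Pi.mul_apply, hyk, hpr w]
      simp [mul_comm]
    rw [hα']
    refine A.add_mem (hev p) (A.sum_mem fun k _ => A.mul_mem (hev _) ?_)
    exact Algebra.subset_adjoin (Or.inr ⟨k, rfl⟩)
  · intro α hα
    induction hα using Algebra.adjoin_induction with
    | mem x hx =>
      rcases hx with (⟨k, rfl⟩ | ⟨k, rfl⟩) | ⟨k, rfl⟩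
      · intro w i j _ _
        simp [tk]
      · intro w i j _ _
        have := ev_gkm w i j (xx k)
        rwa [ev_xx, ev_xx] at this
      · intro w i j hij hj
        rw [hyk, hyk]
        by_cases hjl : j = l
        · subst hjl
          have hi : i ∈ blk n m := by
            simp only [blk, Finset.mem_filter, Finset.mem_univ, true_and]
            rw [Fin.lt_def] at hij
            simp only [hl] at hij hj
            unfold hFun at hj
            split_ifs at hj <;> omega
          have h1 : (X (w i) - X (w l)) ∣ ev w (YY m l) := by
            rw [YY, map_prod, ← neg_sub, neg_dvd]
            have := Finset.dvd_prod_of_mem (fun j => ev w (xx l - xx j)) hi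
            simpa using this
          have h2 : (X (w i) - X (w l)) ∣ ev (w * Equiv.swap i l) (YY m l) := by
            have := dvd_sub h1 (ev_gkm w i l (YY m l))
            simpa using this
          refine dvd_sub ?_ ?_
          · split_ifs
            · exact h1
            · exact dvd_zero _
          · split_ifs
            · exact h2
            · exact dvd_zero _
        · have hil : i ≠ l := by
            rintro rfl
            have := j.2
            rw [Fin.lt_def] at hij
            simp only [hl] at hij
            omega
          have : (w * Equiv.swap i j) l = w l := by
            rw [Equiv.Perm.mul_apply, Equiv.swap_apply_of_ne_of_ne (Ne.symm hil) (Ne.symm hjl)]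
          rw [this]
          split_ifs
          · exact ev_gkm w i j _
          · simp
    | algebraMap z =>
      intro w i j _ _
      simp
    | add x y _ _ hx hy =>
      intro w i j hij hj
      have := dvd_add (hx w i j hij hj) (hy w i j hij hj)
      convert this using 1
      simp only [Pi.add_apply]
      ring
    | mul x y _ _ hx hy =>
      intro w i j hij hj
      have := dvd_add (Dvd.dvd.mul_right (hx w i j hij hj) (y w))
        (Dvd.dvd.mul_left (hy w i j hij hj) (x (w * Equiv.swap i j)))
      convert this using 1
      simp only [Pi.mul_apply]
      ring

end Stmt9
end
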